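/- Let μ be an unbounded sequence of positive integers and q ≥ 1 an integer. The set 𝒰̃^{μ,q}(𝔻) of functions f ∈ H(𝔻) with the following property is a dense G_δ subset of H(𝔻): for every tuple W=(w^{(1)},…,w^{(q)}) of points of ℂ ∖ 𝔻 (ordered by the lexicographical order on polar coordinates (r,θ) ∈ ℝ_+ × [α, α+2π), for any choice of α ∈ [0,2π) different from the arguments of all w^{(i)}), for every compact set K ⊂ ℂ ∖ (𝔻 ∪ W) with connected complement and every h ∈ A(K), there is a subsequence (λ_n)_n of μ such that: a) f ∈ 𝒩_{λ_n,q} for all n ≥ 1; b) [f; λ_n/q] → h in A(K) as n → ∞; c) [f; λ_n/q] → f in H(𝔻) as n → ∞; d) the roots (a_{λ_n}^{(1)},…,a_{λ_n}^{(q)}) of the Padé denominator Q_{λ_n,q}(f), ordered with respect to the same lexicographical order, satisfy a_{λ_n}^{(i)} → w^{(i)} as n → ∞ for each 1 ≤ i ≤ q. -/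

import Mathlib

open Polynomial Filter Finset Metric Topology

noncomputable section

/-- Coefficient sequence extended to integer indices, with `a k = 0` for `k < 0`. -/
def acoefZ (a : ℕ → ℂ) (k : ℤ) : ℂ := if 0 ≤ k then a k.toNat else 0

/-- The Hankel determinant `C_{m,n} = det (a_{m-n+1+i+j})_{0 ≤ i,j ≤ n-1}`. -/
def hankelDet (a : ℕ → ℂ) (m n : ℕ) : ℂ :=
  Matrix.det (Matrix.of fun i j : Fin n => acoefZ a ((m : ℤ) - n + 1 + i + j))

/-- `IsPade a m n P Q` : the rational function `P/Q` is the Padé approximant of type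
`(m,n)` of the formal power series `∑ a_k z^k`. -/
def IsPade (a : ℕ → ℂ) (m n : ℕ) (P Q : Polynomial ℂ) : Prop :=
  P.natDegree ≤ m ∧ Q.natDegree ≤ n ∧ IsCoprime P Q ∧ Q.coeff 0 = 1 ∧
    ∀ j ≤ m + n, (∑ i ∈ Finset.range (j + 1), Q.coeff i * a (j - i)) = P.coeff j

/-- `𝒟_{m,n}` : the set of coefficient sequences whose Hankel determinant `C_{m,n}`
does not vanish. -/
def Dset (m n : ℕ) : Set (ℕ → ℂ) := {a | hankelDet a m n ≠ 0}

/-- `𝒩_{m,n}` : the subset of `𝒟_{m,n}` of series whose Padé denominator has exact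
degree `n`. -/
def Nset (m n : ℕ) : Set (ℕ → ℂ) :=
  {a | hankelDet a m n ≠ 0 ∧
    ∃ P Q : Polynomial ℂ, IsPade a m n P Q ∧ Q.degree = (n : WithBot ℕ)}

/-- The open unit disc in `ℂ`. -/
def unitD : Set ℂ := Metric.ball (0 : ℂ) 1

/-- The submodule of `ℂ → ℂ` of functions holomorphic on `Ω` (normalized to vanish
outside `Ω`, so that a function is determined by its restriction to `Ω`). -/
def holSubmodule (Ω : Set ℂ) : Submodule ℂ (ℂ → ℂ) where
  carrier := {f | DifferentiableOn ℂ f Ω ∧ ∀ z ∉ Ω, f z = 0}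
  add_mem' := fun hf hg => ⟨hf.1.add hg.1, fun z hz => by simp [hf.2 z hz, hg.2 z hz]⟩
  zero_mem' := ⟨differentiableOn_const 0, fun _ _ => rfl⟩
  smul_mem' := fun c f hf => ⟨hf.1.const_smul c, fun z hz => by simp [hf.2 z hz]⟩

/-- `H(Ω)`, the space of holomorphic functions on `Ω`. -/
abbrev Hol (Ω : Set ℂ) := ↥(holSubmodule Ω)

/-- The topology of uniform convergence on compact subsets of `Ω` on `H(Ω)`. -/
instance holTop (Ω : Set ℂ) : TopologicalSpace (Hol Ω) :=
  TopologicalSpace.induced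
    (fun f : Hol Ω => UniformOnFun.ofFun {K : Set Ω | IsCompact K} fun z : Ω => f.1 z)
    inferInstance

/-- The `k`-th Taylor coefficient at `0` of a function `f`. -/
def tc (f : ℂ → ℂ) (k : ℕ) : ℂ := iteratedDeriv k f 0 / k.factorial

/-- The argument of `z` taken in the window `[α, α + 2π)`. -/
def polarArg (α : ℝ) (z : ℂ) : ℝ :=
  α + 2 * Real.pi * Int.fract ((Complex.arg z - α) / (2 * Real.pi))

/-- The (non-strict) lexicographical order on polar coordinates
`(r, θ) ∈ ℝ₊ × [α, α + 2π)`. -/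
def polarLe (α : ℝ) (z w : ℂ) : Prop :=
  ‖z‖ < ‖w‖ ∨ (‖z‖ = ‖w‖ ∧ polarArg α z ≤ polarArg α w)

/-- `g` is a uniform limit of polynomials on `K`. -/
def PolyApprox (K : Set ℂ) (g : ℂ → ℂ) : Prop :=
  ∀ ε > 0, ∃ p : ℂ[X], ∀ z ∈ K, ‖g z - p.eval z‖ < ε

namespace PolyApprox

variable {K : Set ℂ} {f g : ℂ → ℂ}

theorem polynomial (p : ℂ[X]) : PolyApprox K fun z => p.eval z :=
  fun ε hε => ⟨p, fun z _ => by simpa using hε⟩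

theorem const (c : ℂ) : PolyApprox K fun _ => c := by
  simpa using polynomial (K := K) (C c)

theorem of_forall_exists (h : ∀ ε > 0, ∃ f, PolyApprox K f ∧ ∀ z ∈ K, ‖g z - f z‖ < ε) :
    PolyApprox K g := by
  intro ε hε
  obtain ⟨f, hf, hfg⟩ := h (ε / 2) (half_pos hε)
  obtain ⟨p, hp⟩ := hf (ε / 2) (half_pos hε)
  refine ⟨p, fun z hz => ?_⟩
  calc ‖g z - p.eval z‖ = ‖(g z - f z) + (f z - p.eval z)‖ := by ring_nf
    _ ≤ ‖g z - f z‖ + ‖f z - p.eval z‖ := norm_add_le _ _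
    _ < ε := by linarith [hfg z hz, hp z hz]

theorem congr (hf : PolyApprox K f) (h : ∀ z ∈ K, g z = f z) : PolyApprox K g :=
  of_forall_exists fun ε hε => ⟨f, hf, fun z hz => by simpa [h z hz] using hε⟩

theorem add (hf : PolyApprox K f) (hg : PolyApprox K g) : PolyApprox K fun z => f z + g z := by
  intro ε hε
  obtain ⟨p, hp⟩ := hf (ε / 2) (half_pos hε)
  obtain ⟨r, hr⟩ := hg (ε / 2) (half_pos hε)
  refine ⟨p + r, fun z hz => ?_⟩
  calc ‖f z + g z - (p + r).eval z‖ = ‖(f z - p.eval z) + (g z - r.eval z)‖ := by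
        rw [eval_add]; ring_nf
    _ ≤ ‖f z - p.eval z‖ + ‖g z - r.eval z‖ := norm_add_le _ _
    _ < ε := by linarith [hp z hz, hr z hz]

theorem exists_bound (hK : IsCompact K) (hf : PolyApprox K f) :
    ∃ M, 0 < M ∧ ∀ z ∈ K, ‖f z‖ ≤ M := by
  obtain ⟨p, hp⟩ := hf 1 one_pos
  obtain ⟨M, hM⟩ := hK.exists_bound_of_continuousOn (f := fun z => p.eval z) p.continuousOn
  refine ⟨max M 0 + 1, by positivity, fun z hz => ?_⟩
  calc ‖f z‖ = ‖(f z - p.eval z) + p.eval z‖ := by ring_nf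
    _ ≤ ‖f z - p.eval z‖ + ‖p.eval z‖ := norm_add_le _ _
    _ ≤ _ := by linarith [hp z hz, hM z hz, le_max_left M 0]

theorem mul (hK : IsCompact K) (hf : PolyApprox K f) (hg : PolyApprox K g) :
    PolyApprox K fun z => f z * g z := by
  obtain ⟨M, hM, hfM⟩ := hf.exists_bound hK
  refine of_forall_exists fun ε hε => ?_
  obtain ⟨r, hr⟩ := hg (ε / (2 * M)) (by positivity)
  obtain ⟨B, hB⟩ := hK.exists_bound_of_continuousOn (f := fun z => r.eval z) r.continuousOn
  obtain ⟨p, hp⟩ := hf (ε / (2 * (max B 0 + 1))) (by positivity)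
  refine ⟨fun z => (p * r).eval z, polynomial _, fun z hz => ?_⟩
  have h1 : ‖f z * (g z - r.eval z)‖ ≤ ε / 2 := by
    rw [norm_mul]
    calc _ ≤ M * (ε / (2 * M)) := by gcongr; exacts [hfM z hz, (hr z hz).le]
      _ = ε / 2 := by field_simp
  have h2 : ‖(f z - p.eval z) * r.eval z‖ < ε / 2 := by
    rw [norm_mul]
    calc _ ≤ ‖f z - p.eval z‖ * (max B 0 + 1) := by
          gcongr; linarith [hB z hz, le_max_left B 0]
      _ < ε / (2 * (max B 0 + 1)) * (max B 0 + 1) := by gcongr; exact hp z hz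
      _ = ε / 2 := by field_simp
  calc ‖f z * g z - (p * r).eval z‖
      = ‖f z * (g z - r.eval z) + (f z - p.eval z) * r.eval z‖ := by rw [eval_mul]; ring_nf
    _ ≤ _ := norm_add_le _ _
    _ < ε := by linarith

theorem const_mul (hK : IsCompact K) (c : ℂ) (hf : PolyApprox K f) :
    PolyApprox K fun z => c * f z := (const c).mul hK hf

theorem polynomial_comp (hK : IsCompact K) (p : ℂ[X]) (hf : PolyApprox K f) :
    PolyApprox K fun z => p.eval (f z) := by
  induction p using Polynomial.induction_on' with
  | add p r hp hr => simpa using hp.add hr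
  | monomial n a =>
    simp only [eval_monomial]
    refine PolyApprox.const_mul hK a ?_
    induction n with
    | zero => simpa using const 1
    | succ n ih => simpa [pow_succ] using ih.mul hK hf

theorem holomorphic_comp (hK : IsCompact K) {F : ℂ → ℂ} (hF : DifferentiableOn ℂ F (ball 0 1))
    (hf : PolyApprox K f) (hfK : ∀ z ∈ K, ‖f z‖ ≤ 1 / 2) : PolyApprox K fun z => F (f z) := by
  refine of_forall_exists fun ε hε => ?_
  have h1 : HasFPowerSeriesOnBall F (cauchyPowerSeries F 0 (3 / 4 : NNReal)) 0 (3 / 4 : NNReal) := by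
    refine DifferentiableOn.hasFPowerSeriesOnBall (hF.mono ?_) (by norm_num)
    refine closedBall_subset_ball ?_
    norm_num
  have h2 := h1.tendstoUniformlyOn (r' := (2 / 3 : NNReal)) (by
    rw [ENNReal.coe_lt_coe, ← NNReal.coe_lt_coe]; norm_num)
  rw [Metric.tendstoUniformlyOn_iff] at h2
  obtain ⟨n, hn⟩ := (h2 ε hε).exists
  let p : ℂ[X] := ∑ k ∈ Finset.range n,
    Polynomial.monomial k ((cauchyPowerSeries F 0 (3 / 4 : NNReal)).coeff k)
  refine ⟨fun z => p.eval (f z), hf.polynomial_comp hK p, fun z hz => ?_⟩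
  have := hn (f z) (by
    rw [mem_ball_zero_iff]
    refine (hfK z hz).trans_lt ?_
    norm_num)
  rw [dist_eq_norm, zero_add] at this
  have h3 : p.eval (f z) =
      (cauchyPowerSeries F 0 (3 / 4 : NNReal)).partialSum n (f z) := by
    simp only [p, FormalMultilinearSeries.partialSum, eval_finsetSum, eval_monomial,
      FormalMultilinearSeries.apply_eq_pow_smul_coeff, smul_eq_mul, mul_comm]
  change ‖_ - p.eval (f z)‖ < ε
  rwa [h3]

end PolyApprox

theorem exists_far_notMem {K : Set ℂ} (hK : IsCompact K) (b : ℂ) (R : ℝ) :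
    ∃ p ∉ K, R ≤ ‖p - b‖ ∧ ∀ z ∈ K, ‖z‖ ≤ ‖p‖ / 2 := by
  obtain ⟨M, hM⟩ := hK.isBounded.exists_norm_le
  refine ⟨((2 * max M 0 + |R| + ‖b‖ + 1 : ℝ) : ℂ), ?_, ?_, ?_⟩
  · intro h
    have := hM _ h
    rw [Complex.norm_of_nonneg (by positivity)] at this
    linarith [abs_nonneg R, norm_nonneg b, le_max_left M 0, le_max_right M 0]
  · have := norm_sub_norm_le (((2 * max M 0 + |R| + ‖b‖ + 1 : ℝ) : ℂ)) b
    rw [Complex.norm_of_nonneg (by positivity)] at this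
    linarith [le_abs_self R, le_max_right M 0]
  · intro z hz
    rw [Complex.norm_of_nonneg (by positivity)]
    linarith [hM z hz, abs_nonneg R, norm_nonneg b, le_max_left M 0, le_max_right M 0]

theorem exists_radius_of_notMem {K : Set ℂ} (hK : IsCompact K) {x : ℂ} (hx : x ∉ K) :
    ∃ r > 0, ∀ y, ‖y - x‖ < r → ∀ z ∈ K, ‖y - x‖ ≤ ‖z - x‖ / 2 ∧ ‖x - y‖ ≤ ‖z - y‖ / 2 := by
  obtain ⟨r, hr, hrK⟩ := Metric.isOpen_iff.1 hK.isClosed.isOpen_compl x hx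
  refine ⟨r / 3, by positivity, fun y hy z hz => ?_⟩
  have h1 : r ≤ ‖z - x‖ := by
    by_contra! h
    exact hrK (by rwa [mem_ball, dist_eq_norm]) hz
  have h2 : ‖z - x‖ ≤ ‖z - y‖ + ‖y - x‖ := by
    simpa using norm_add_le (z - y) (y - x)
  rw [norm_sub_rev x y]
  constructor <;> linarith

theorem IsPreconnected.forall_of_eventually_iff {U : Set ℂ} (hU : IsPreconnected U)
    {G : ℂ → Prop} (h : ∀ x ∈ U, ∀ᶠ y in 𝓝[U] x, (G x ↔ G y)) {x y : ℂ} (hx : x ∈ U)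
    (hy : y ∈ U) (hGx : G x) : G y :=
  (hU.induction₂' (fun x y => G x ↔ G y)
    (fun x hx => (h x hx).mono fun _ hy => ⟨hy, hy.symm⟩)
    (fun _ _ _ _ _ _ h1 h2 => h1.trans h2) hx hy).1 hGx

namespace PolyApprox

variable {K : Set ℂ}

theorem inv_sub_of_near (hK : IsCompact K) {p p' : ℂ} (hp : p ∉ K)
    (h : ∀ z ∈ K, ‖p' - p‖ ≤ ‖z - p‖ / 2) (hA : PolyApprox K fun z => (z - p)⁻¹) :
    PolyApprox K fun z => (z - p')⁻¹ := by
  have hF : DifferentiableOn ℂ (fun y : ℂ => (1 - y)⁻¹) (ball 0 1) := by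
    refine (differentiableOn_const 1 |>.sub differentiableOn_id).inv fun y hy h0 => ?_
    have : y = 1 := (sub_eq_zero.1 h0).symm
    simp [this] at hy
  have hy : PolyApprox K fun z => (p' - p) * (z - p)⁻¹ := hA.const_mul hK _
  refine (hA.mul hK (hy.holomorphic_comp hK hF ?_)).congr fun z hz => ?_
  · intro z hz
    have h0 : 0 < ‖z - p‖ := norm_pos_iff.2 (sub_ne_zero.2 fun e => hp (e ▸ hz))
    rw [norm_mul, norm_inv, ← div_eq_mul_inv, div_le_iff₀ h0]
    linarith [h z hz]
  · have h0 : z - p ≠ 0 := sub_ne_zero.2 fun e => hp (e ▸ hz)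
    rw [← mul_inv]
    congr 1
    field_simp
    ring

theorem inv_sub (hK : IsCompact K) (hKc : IsPreconnected Kᶜ) {p : ℂ} (hp : p ∉ K) :
    PolyApprox K fun z => (z - p)⁻¹ := by
  obtain ⟨c, hcK, hc1, hc⟩ := exists_far_notMem hK 0 1
  have hc0 : c ≠ 0 := by
    rintro rfl
    norm_num at hc1
  refine hKc.forall_of_eventually_iff (G := fun p => PolyApprox K fun z => (z - p)⁻¹)
    (fun x hx => ?_) hcK hp ?_
  · obtain ⟨r, hr, hrK⟩ := exists_radius_of_notMem hK hx
    filter_upwards [mem_nhdsWithin_of_mem_nhds (ball_mem_nhds x hr), self_mem_nhdsWithin]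
      with y hy hyK
    rw [mem_ball, dist_eq_norm] at hy
    exact ⟨inv_sub_of_near hK hx fun z hz => (hrK y hy z hz).1,
      inv_sub_of_near hK hyK fun z hz => (hrK y hy z hz).2⟩
  · have hF : DifferentiableOn ℂ (fun y : ℂ => (1 - y)⁻¹) (ball 0 1) := by
      refine (differentiableOn_const 1 |>.sub differentiableOn_id).inv fun y hy h0 => ?_
      have : y = 1 := (sub_eq_zero.1 h0).symm
      simp [this] at hy
    have hy : PolyApprox K fun z => z * c⁻¹ :=
      (polynomial (K := K) (X * C c⁻¹)).congr fun z _ => by simpa using mul_comm z c⁻¹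
    refine ((hy.holomorphic_comp hK hF ?_).const_mul hK (-c⁻¹)).congr fun z hz => ?_
    · intro z hz
      rw [norm_mul, norm_inv, ← div_eq_mul_inv, div_le_iff₀ (norm_pos_iff.2 hc0)]
      linarith [hc z hz]
    · rw [neg_mul, ← mul_inv, ← inv_neg]
      congr 1
      field_simp
      ring

end PolyApprox

theorem Complex.sqrt_mul_self (x : ℂ) : Complex.sqrt x * Complex.sqrt x = x := by
  rw [← sq, Complex.sqrt]
  exact Complex.cpow_ofNat_inv_pow x 2

theorem Complex.re_sqrt_one_add_pos {y : ℂ} (hy : ‖y‖ < 1) : 0 < (Complex.sqrt (1 + y)).re := by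
  rw [Complex.sqrt, Complex.cpow_inv_two_re]
  have h1 := (abs_le.1 (Complex.abs_re_le_norm y)).1
  have h2 : 0 < (1 + y).re := by simp; linarith
  positivity

/-- On `K` there is a uniform limit of polynomials which squares to `(z - p) / (z - b)` and
is close to the principal square root at points far from `b`. -/
def HasSqrtApprox (K : Set ℂ) (b p : ℂ) : Prop :=
  ∃ s : ℂ → ℂ, PolyApprox K s ∧
    ∀ z ∈ K, s z * s z = (z - p) / (z - b) ∧ (8 ≤ ‖z - b‖ → ‖1 - s z‖ ≤ 1 / 4)

theorem HasSqrtApprox.refl {K : Set ℂ} {b : ℂ} (hb : b ∉ K) : HasSqrtApprox K b b := by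
  refine ⟨fun _ => 1, .const 1, fun z hz => ?_⟩
  have h0 : z - b ≠ 0 := sub_ne_zero.2 fun e => hb (e ▸ hz)
  simp [h0]

theorem HasSqrtApprox.of_near {K : Set ℂ} (hK : IsCompact K) (hKc : IsPreconnected Kᶜ) {b p p' : ℂ}
    (hb : b ∉ K) (hp : p ∉ K) (hp' : ‖p' - b‖ ≤ 2) (h : ∀ z ∈ K, ‖p' - p‖ ≤ ‖z - p‖ / 2)
    (hA : HasSqrtApprox K b p) : HasSqrtApprox K b p' := by
  obtain ⟨s, hs, hsK⟩ := hA
  have hF : DifferentiableOn ℂ (fun y : ℂ => Complex.sqrt (1 + y)) (ball 0 1) := by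
    intro y hy
    rw [mem_ball_zero_iff] at hy
    have h1 := (abs_le.1 (Complex.abs_re_le_norm y)).1
    refine ((Complex.differentiableAt_sqrt (Or.inl ?_)).comp y
      (by fun_prop)).differentiableWithinAt
    simp; linarith
  have hy : PolyApprox K fun z => (p - p') * (z - p)⁻¹ :=
    (PolyApprox.inv_sub hK hKc hp).const_mul hK _
  have hyK : ∀ z ∈ K, ‖(p - p') * (z - p)⁻¹‖ ≤ 1 / 2 := by
    intro z hz
    have h0 : 0 < ‖z - p‖ := norm_pos_iff.2 (sub_ne_zero.2 fun e => hp (e ▸ hz))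
    rw [norm_mul, norm_inv, ← div_eq_mul_inv, div_le_iff₀ h0, norm_sub_rev]
    linarith [h z hz]
  refine ⟨_, hs.mul hK (hy.holomorphic_comp hK hF hyK), fun z hz => ?_⟩
  obtain ⟨hs1, hs2⟩ := hsK z hz
  have hzp : z - p ≠ 0 := sub_ne_zero.2 fun e => hp (e ▸ hz)
  have hzb : z - b ≠ 0 := sub_ne_zero.2 fun e => hb (e ▸ hz)
  set y := (p - p') * (z - p)⁻¹ with hydef
  set v := Complex.sqrt (1 + y) with hv
  have hvv : v * v = 1 + y := Complex.sqrt_mul_self _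
  have hvre : 0 < v.re := Complex.re_sqrt_one_add_pos ((hyK z hz).trans_lt (by norm_num))
  have hsq : s z * v * (s z * v) = (z - p') / (z - b) := by
    calc s z * v * (s z * v) = (s z * s z) * (v * v) := by ring
      _ = (z - p') / (z - b) := by
        rw [hs1, hvv, hydef]
        field_simp
        ring
  refine ⟨hsq, fun hfar => ?_⟩
  have hx : ‖(b - p') / (z - b)‖ ≤ 1 / 4 := by
    rw [norm_div, div_le_iff₀ (by linarith), norm_sub_rev]
    linarith
  set σ := Complex.sqrt (1 + (b - p') / (z - b)) with hσ
  have hσσ : σ * σ = 1 + (b - p') / (z - b) := Complex.sqrt_mul_self _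
  have hσre : 0 < σ.re := Complex.re_sqrt_one_add_pos (hx.trans_lt (by norm_num))
  have hσ1 : ‖1 - σ‖ ≤ 1 / 4 := by
    have h1 : (1 - σ) * (1 + σ) = -((b - p') / (z - b)) := by linear_combination -hσσ
    have h2 : 1 ≤ ‖1 + σ‖ := by
      refine le_trans ?_ (Complex.re_le_norm _)
      simp; linarith
    have h3 : ‖1 - σ‖ * ‖1 + σ‖ ≤ 1 / 4 := by
      rw [← norm_mul, h1, norm_neg]; exact hx
    nlinarith [norm_nonneg (1 - σ)]
  have h4 : (s z * v) * (s z * v) = σ * σ := by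
    rw [hsq, hσσ]
    field_simp
    ring
  rcases mul_self_eq_mul_self_iff.1 h4 with h5 | h5
  · rw [h5]; exact hσ1
  · exfalso
    have h6 : v + 1 = v * (1 - s z) + (1 - σ) := by linear_combination h5
    have h7 : ‖v + 1‖ ≤ ‖v‖ * (1 / 4) + 1 / 4 := by
      rw [h6]
      refine (norm_add_le _ _).trans (add_le_add ?_ hσ1)
      rw [norm_mul]
      gcongr
      exact hs2 hfar
    have h8 : 1 < ‖v + 1‖ := by
      refine lt_of_lt_of_le ?_ (Complex.re_le_norm _)
      simpa using hvre
    have h9 : ‖v‖ ≤ ‖v + 1‖ + 1 := by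
      simpa using norm_sub_le (v + 1) 1
    linarith

theorem exists_hasSqrtApprox {K : Set ℂ} (hK : IsCompact K) (hKc : IsPreconnected Kᶜ) {b : ℂ}
    (hb : b ∉ K) : ∃ a, 1 ≤ ‖a - b‖ ∧ ‖a - b‖ ≤ 2 ∧ HasSqrtApprox K b a := by
  by_contra! hcon
  obtain ⟨c, hcK, hc1, -⟩ := exists_far_notMem hK b 1
  have := hKc.forall_of_eventually_iff (G := fun p => ‖p - b‖ < 1 ∧ HasSqrtApprox K b p)
    (fun x hx => ?_) hb hcK ⟨by simp, .refl hb⟩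
  · linarith [this.1]
  obtain ⟨r, hr, hrK⟩ := exists_radius_of_notMem hK hx
  filter_upwards [mem_nhdsWithin_of_mem_nhds (ball_mem_nhds x (lt_min hr one_pos)),
    self_mem_nhdsWithin] with y hy hyK
  rw [mem_ball, dist_eq_norm, lt_min_iff] at hy
  have key : ∀ p p', p ∉ K → ‖p' - p‖ < 1 → (∀ z ∈ K, ‖p' - p‖ ≤ ‖z - p‖ / 2) →
      (‖p - b‖ < 1 ∧ HasSqrtApprox K b p) → ‖p' - b‖ < 1 ∧ HasSqrtApprox K b p' := by
    intro p p' hp h1 h2 h3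
    have h4 : ‖p' - b‖ ≤ ‖p' - p‖ + ‖p - b‖ := by
      simpa using norm_add_le (p' - p) (p - b)
    have h5 := h3.2.of_near hK hKc hb hp (p' := p') (by linarith) h2
    refine ⟨?_, h5⟩
    by_contra! h6
    exact hcon p' h6 (by linarith) h5
  refine ⟨key x y hx hy.2 fun z hz => (hrK y hy.1 z hz).1, key y x hyK ?_ fun z hz =>
    (hrK y hy.1 z hz).2⟩
  rw [norm_sub_rev]
  exact hy.2

theorem norm_cauchyKernel_sub_le_far {u α β t : ℂ} (hα1 : 1 ≤ ‖α‖) (hα2 : ‖α‖ ≤ 2)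
    (hu : 8 ≤ ‖u‖) (hβ : ‖β‖ ≤ 4) (ht : ‖t‖ ≤ 1 / 4) (hαt : α = u * (t * (2 - t))) :
    ‖4 * t / (α * (2 - t)) + (β - α / 2) * (4 * t / (α * (2 - t))) ^ 2 - (u - β)⁻¹‖
      ≤ 93 / ‖u‖ ^ 3 := by
  have hα0 : α ≠ 0 := norm_pos_iff.1 (by linarith)
  have hu0 : u ≠ 0 := norm_pos_iff.1 (by linarith)
  have ht2 : 7 / 4 ≤ ‖2 - t‖ := by
    have := norm_sub_norm_le (2 : ℂ) t
    rw [Complex.norm_ofNat] at this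
    linarith
  have ht20 : 2 - t ≠ 0 := norm_pos_iff.1 (by linarith)
  have huβ : ‖u‖ / 2 ≤ ‖u - β‖ := by
    have := norm_sub_norm_le u β
    linarith
  have huβ0 : u - β ≠ 0 := norm_pos_iff.1 (by linarith)
  have ht0 : t ≠ 0 := by
    rintro rfl
    simp [hα0] at hαt
  have htu : ‖t‖ ≤ ‖α‖ / ‖u‖ := by
    rw [le_div_iff₀ (by linarith), hαt, norm_mul, norm_mul]
    nlinarith [norm_nonneg t, mul_nonneg (norm_nonneg t) (norm_nonneg u)]
  set n := ‖u‖ with hn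
  set g := 4 * t / (α * (2 - t)) with hg
  have hu' : u⁻¹ = t * (2 - t) / α := by
    rw [hαt]
    field_simp
  have e1 : g - u⁻¹ - α / 2 * u⁻¹ ^ 2
      = t / (α * (2 - t)) * (5 * t ^ 2 - 3 * t ^ 3 + t ^ 4 / 2) := by
    rw [hu', hg]
    field_simp
    ring
  have n1 : ‖g - u⁻¹ - α / 2 * u⁻¹ ^ 2‖ ≤ 16 / n ^ 3 := by
    have h1 : ‖5 * t ^ 2 - 3 * t ^ 3 + t ^ 4 / 2‖ ≤ 7 * ‖t‖ ^ 2 := by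
      have h2 : 5 * t ^ 2 - 3 * t ^ 3 + t ^ 4 / 2 = t ^ 2 * (5 - 3 * t + t ^ 2 / 2) := by ring
      have h3 : ‖5 - 3 * t + t ^ 2 / 2‖ ≤ 7 := by
        calc _ ≤ ‖(5 : ℂ) - 3 * t‖ + ‖t ^ 2 / 2‖ := norm_add_le _ _
          _ ≤ ‖(5 : ℂ)‖ + ‖3 * t‖ + ‖t ^ 2 / 2‖ := by gcongr; exact norm_sub_le _ _
          _ = 5 + 3 * ‖t‖ + ‖t‖ ^ 2 / 2 := by simp
          _ ≤ 7 := by nlinarith [norm_nonneg t]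
      rw [h2, norm_mul, norm_pow, mul_comm]
      gcongr
    rw [e1, norm_mul, norm_div, norm_mul]
    calc _ ≤ ‖t‖ / (‖α‖ * (7 / 4)) * (7 * ‖t‖ ^ 2) := by gcongr
      _ = 4 / ‖α‖ * ‖t‖ ^ 3 := by field_simp
      _ ≤ 4 / ‖α‖ * (‖α‖ / n) ^ 3 := by gcongr
      _ = 4 * ‖α‖ ^ 2 / n ^ 3 := by field_simp
      _ ≤ 4 * 2 ^ 2 / n ^ 3 := by gcongr
      _ = 16 / n ^ 3 := by norm_num
  have n2 : ‖g - u⁻¹‖ ≤ 3 / n ^ 2 := by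
    have h1 : g - u⁻¹ = (g - u⁻¹ - α / 2 * u⁻¹ ^ 2) + α / 2 * u⁻¹ ^ 2 := by ring
    have h2 : ‖α / 2 * u⁻¹ ^ 2‖ ≤ 1 / n ^ 2 := by
      rw [norm_mul, norm_div, norm_pow, norm_inv, Complex.norm_ofNat, inv_pow, ← div_eq_mul_inv]
      gcongr
      linarith
    rw [h1]
    calc _ ≤ 16 / n ^ 3 + 1 / n ^ 2 := (norm_add_le _ _).trans (add_le_add n1 h2)
      _ = (16 / n + 1) / n ^ 2 := by field_simp
      _ ≤ (16 / 8 + 1) / n ^ 2 := by gcongr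
      _ = 3 / n ^ 2 := by norm_num
  have n3 : ‖g ^ 2 - u⁻¹ ^ 2‖ ≤ 9 / n ^ 3 := by
    have h1 : ‖g + u⁻¹‖ ≤ 3 / n := by
      have : g + u⁻¹ = (g - u⁻¹) + 2 * u⁻¹ := by ring
      rw [this]
      calc _ ≤ 3 / n ^ 2 + 2 / n := by
            refine (norm_add_le _ _).trans (add_le_add n2 ?_)
            simp [div_eq_mul_inv, hn]
        _ = (3 / n + 2) / n := by field_simp
        _ ≤ (3 / 8 + 2) / n := by gcongr
        _ ≤ 3 / n := by gcongr; norm_num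
    rw [sq_sub_sq, norm_mul]
    calc _ ≤ 3 / n * (3 / n ^ 2) := by gcongr
      _ = 9 / n ^ 3 := by ring
  have e2 : g + (β - α / 2) * g ^ 2 - (u - β)⁻¹ = (g - u⁻¹ - α / 2 * u⁻¹ ^ 2)
      + (β - α / 2) * (g ^ 2 - u⁻¹ ^ 2) - β ^ 2 * (u⁻¹ ^ 2 * (u - β)⁻¹) := by
    field_simp
    ring
  have n4 : ‖(β - α / 2) * (g ^ 2 - u⁻¹ ^ 2)‖ ≤ 45 / n ^ 3 := by
    have h1 : ‖β - α / 2‖ ≤ 5 := by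
      refine (norm_sub_le _ _).trans ?_
      rw [norm_div, Complex.norm_ofNat]
      linarith
    rw [norm_mul]
    calc _ ≤ 5 * (9 / n ^ 3) := by gcongr
      _ = 45 / n ^ 3 := by ring
  have n5 : ‖β ^ 2 * (u⁻¹ ^ 2 * (u - β)⁻¹)‖ ≤ 32 / n ^ 3 := by
    rw [norm_mul, norm_mul, norm_pow, norm_pow, norm_inv, norm_inv]
    calc _ ≤ 4 ^ 2 * (n⁻¹ ^ 2 * (n / 2)⁻¹) := by gcongr
      _ = 32 / n ^ 3 := by field_simp; norm_num
  rw [e2]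
  calc _ ≤ 16 / n ^ 3 + 45 / n ^ 3 + 32 / n ^ 3 := by
        refine (norm_sub_le _ _).trans (add_le_add ((norm_add_le _ _).trans (add_le_add n1 n4)) n5)
    _ = 93 / n ^ 3 := by ring

/-- The error kernel in the approximation of the Cauchy kernel. -/
def errKernel (v : ℂ) : ℝ := (‖v‖ * (1 + ‖v‖ ^ 2))⁻¹

theorem exists_approx_cauchyKernel {K : Set ℂ} (hK : IsCompact K) (hKc : IsPreconnected Kᶜ)
    {b : ℂ} (hb : b ∉ K) : ∃ (g : ℂ → ℂ) (m : ℂ), PolyApprox K g ∧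
      ∀ z ∈ K, ∀ ζ, ‖ζ - b‖ ≤ 4 → ζ ≠ z →
        ‖g z + (ζ - m) * g z ^ 2 - (z - ζ)⁻¹‖ ≤ 2 * 10 ^ 8 * errKernel (z - ζ) := by
  obtain ⟨a, ha1, ha2, s, hs, hsK⟩ := exists_hasSqrtApprox hK hKc hb
  set α := a - b with hα
  have hα0 : α ≠ 0 := norm_pos_iff.1 (by linarith)
  refine ⟨fun z => 8 / α ^ 2 * ((z - b) - α / 2 - (z - b) * s z), b + α / 2, ?_, ?_⟩
  · refine PolyApprox.const_mul hK _ ?_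
    have h1 : PolyApprox K fun z => z - b :=
      (PolyApprox.polynomial (X - C b)).congr fun z _ => by simp
    refine ((h1.add (.const (-(α / 2)))).add ((h1.mul hK hs).const_mul hK (-1))).congr
      fun z _ => ?_
    ring
  · intro z hz ζ hζ hne
    obtain ⟨hs1, hs2⟩ := hsK z hz
    set u := z - b with hu
    set β := ζ - b with hβ
    have hu0 : u ≠ 0 := sub_ne_zero.2 fun e => hb (e ▸ hz)
    have hv : z - ζ = u - β := by rw [hu, hβ]; ring
    have hza : z - a = u - α := by rw [hu, hα]; ring
    have hζm : ζ - (b + α / 2) = β - α / 2 := by rw [hβ]; ring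
    have hv0 : 0 < ‖u - β‖ := by
      rw [← hv]; exact norm_pos_iff.2 (sub_ne_zero.2 hne.symm)
    rw [hza] at hs1
    have hvle : ‖u - β‖ ≤ ‖u‖ + 4 := (norm_sub_le _ _).trans (by linarith)
    rw [hζm, hv]
    simp only [errKernel]
    rw [← div_eq_mul_inv, le_div_iff₀ (by positivity)]
    rcases le_or_gt 8 ‖u‖ with h8 | h8
    · have ht := hs2 h8
      set t := 1 - s z with htdef
      have hst : s z = 1 - t := by rw [htdef]; ring
      have hαt : α = u * (t * (2 - t)) := by
        have h1 : s z * s z * u = u - α := by rw [hs1]; field_simp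
        rw [hst] at h1
        linear_combination h1
      have ht20 : 2 - t ≠ 0 := by
        intro h
        have : t = 2 := (sub_eq_zero.1 h).symm
        rw [this, Complex.norm_ofNat] at ht
        norm_num at ht
      have hg : 8 / α ^ 2 * (u - α / 2 - u * s z) = 4 * t / (α * (2 - t)) := by
        have h1 : u * t * (2 - t) = α := by rw [hαt]; ring
        rw [hst]
        field_simp
        linear_combination 16 * h1
      rw [hg]
      have hfar := norm_cauchyKernel_sub_le_far ha1 ha2 h8 hζ ht hαt
      have h2 : ‖u - β‖ ≤ 3 / 2 * ‖u‖ := by linarith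
      calc _ ≤ 93 / ‖u‖ ^ 3 * (3 / 2 * ‖u‖ * (1 + (3 / 2 * ‖u‖) ^ 2)) := by gcongr
        _ ≤ 93 / ‖u‖ ^ 3 * (3 / 2 * ‖u‖ * (‖u‖ ^ 2 + (3 / 2 * ‖u‖) ^ 2)) := by
          gcongr; nlinarith
        _ = 93 * (3 / 2) * (1 + 9 / 4) := by
          have : ‖u‖ ≠ 0 := by linarith
          field_simp
          ring
        _ ≤ 2 * 10 ^ 8 := by norm_num
    · have hus : ‖u * s z‖ ≤ 9 := by
        have h1 : (u * s z) * (u * s z) = u * (u - α) := by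
          calc _ = u * u * (s z * s z) := by ring
            _ = _ := by rw [hs1]; field_simp
        have h2 : ‖u * s z‖ * ‖u * s z‖ ≤ 8 * 10 := by
          rw [← norm_mul, h1, norm_mul]
          have : ‖u - α‖ ≤ 10 := (norm_sub_le _ _).trans (by linarith)
          gcongr
        nlinarith [norm_nonneg (u * s z)]
      set g := 8 / α ^ 2 * (u - α / 2 - u * s z) with hg
      have hgn : ‖g‖ ≤ 144 := by
        have h1 : ‖8 / α ^ 2‖ ≤ 8 := by
          rw [norm_div, norm_pow, Complex.norm_ofNat]
          exact div_le_self (by norm_num) (one_le_pow₀ ha1)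
        have h2 : ‖u - α / 2 - u * s z‖ ≤ 18 := by
          have h3 : ‖α / 2‖ ≤ 1 := by
            rw [norm_div, Complex.norm_ofNat]; linarith
          have := norm_sub_le (u - α / 2) (u * s z)
          have := norm_sub_le u (α / 2)
          linarith
        rw [hg, norm_mul]
        calc _ ≤ (8 : ℝ) * 18 := by gcongr
          _ = 144 := by norm_num
      have h1 : ‖β - α / 2‖ ≤ 5 := by
        refine (norm_sub_le _ _).trans ?_
        rw [norm_div, Complex.norm_ofNat]
        linarith
      have h2 : ‖g + (β - α / 2) * g ^ 2‖ ≤ 144 + 5 * 144 ^ 2 := by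
        refine (norm_add_le _ _).trans ?_
        rw [norm_mul (β - α / 2), norm_pow]
        gcongr
      have h3 : ‖g + (β - α / 2) * g ^ 2 - (u - β)⁻¹‖ ≤ 144 + 5 * 144 ^ 2 + ‖u - β‖⁻¹ := by
        refine (norm_sub_le _ _).trans ?_
        rw [norm_inv]
        gcongr
      have h4 : ‖u - β‖ ≤ 12 := by linarith
      calc _ ≤ (144 + 5 * 144 ^ 2 + ‖u - β‖⁻¹) * (‖u - β‖ * (1 + ‖u - β‖ ^ 2)) := by gcongr
        _ = (144 + 5 * 144 ^ 2) * (‖u - β‖ * (1 + ‖u - β‖ ^ 2)) + (1 + ‖u - β‖ ^ 2) := by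
          field_simp
        _ ≤ (144 + 5 * 144 ^ 2) * (12 * (1 + 12 ^ 2)) + (1 + 12 ^ 2) := by gcongr
        _ ≤ 2 * 10 ^ 8 := by norm_num

section CauchyTransform
open MeasureTheory

theorem errKernel_nonneg (v : ℂ) : 0 ≤ errKernel v := by
  unfold errKernel; positivity

theorem integrable_errKernel : Integrable errKernel := by
  have h := integrable_fun_norm_addHaar (E := ℂ) volume (f := fun y : ℝ => (y * (1 + y ^ 2))⁻¹)
  rw [Complex.finrank_real_complex] at h
  refine h.2 ?_
  refine (integrable_inv_one_add_sq.integrableOn (s := Set.Ioi 0)).congr_fun ?_ measurableSet_Ioi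
  intro y hy
  have : y ≠ 0 := ne_of_gt hy
  simp
  field_simp

theorem integrable_errKernel_sub (z : ℂ) : Integrable fun ζ => errKernel (z - ζ) :=
  integrable_errKernel.comp_sub_left z

theorem measurable_errKernel : Measurable errKernel := by
  unfold errKernel; fun_prop

/-- The Cauchy–Riemann operator `∂/∂z̄`. -/
def dbar (Φ : ℂ → ℂ) (z : ℂ) : ℂ := (fderiv ℝ Φ z 1 + Complex.I * fderiv ℝ Φ z Complex.I) / 2

theorem continuous_dbar {Φ : ℂ → ℂ} (hΦ : ContDiff ℝ 1 Φ) : Continuous (dbar Φ) := by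
  have := hΦ.continuous_fderiv (by norm_num)
  unfold dbar
  fun_prop

theorem dbar_eq_zero_of_differentiableAt {Φ : ℂ → ℂ} {z : ℂ} (h : DifferentiableAt ℂ Φ z) :
    dbar Φ z = 0 := by
  have h1 := (h.hasFDerivAt.restrictScalars ℝ).fderiv
  unfold dbar
  rw [h1]
  have : fderiv ℂ Φ z Complex.I = Complex.I * fderiv ℂ Φ z 1 := by
    rw [← smul_eq_mul, ← map_smul]; simp
  simp only [ContinuousLinearMap.coe_restrictScalars', this, ← mul_assoc, Complex.I_mul_I]
  ring

theorem norm_dbar_le (Φ : ℂ → ℂ) (z : ℂ) : ‖dbar Φ z‖ ≤ ‖fderiv ℝ Φ z‖ := by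
  have h1 : ‖fderiv ℝ Φ z 1‖ ≤ ‖fderiv ℝ Φ z‖ := by
    simpa using (fderiv ℝ Φ z).le_opNorm 1
  have h2 : ‖fderiv ℝ Φ z Complex.I‖ ≤ ‖fderiv ℝ Φ z‖ := by
    simpa using (fderiv ℝ Φ z).le_opNorm Complex.I
  unfold dbar
  rw [norm_div, Complex.norm_ofNat]
  have := norm_add_le (fderiv ℝ Φ z 1) (Complex.I * fderiv ℝ Φ z Complex.I)
  rw [norm_mul, Complex.norm_I, one_mul] at this
  linarith

theorem tsupport_dbar_subset (Φ : ℂ → ℂ) : tsupport (dbar Φ) ⊆ tsupport Φ := by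
  refine closure_minimal (fun z hz => ?_) (isClosed_tsupport _)
  refine tsupport_fderiv_subset ℝ (subset_tsupport _ ?_)
  rw [Function.mem_support] at hz ⊢
  intro h
  simp [dbar, h] at hz

/-- Cauchy–Pompeiu at the origin for a compactly supported function. -/
theorem integral_dbar_mul_inv {Φ : ℂ → ℂ} (hΦ : ContDiff ℝ 1 Φ) (hc : HasCompactSupport Φ) :
    ∫ ζ, dbar Φ ζ * ζ⁻¹ = -Real.pi * Φ 0 := by
  have hcont := hΦ.continuous_fderiv (by norm_num)
  have hdiff : Differentiable ℝ Φ := hΦ.differentiable (by norm_num)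
  obtain ⟨R, hR⟩ : ∃ R : ℝ, ∀ z, R < ‖z‖ → z ∉ tsupport Φ := by
    obtain ⟨R, hR⟩ := (hc.isCompact.isBounded).exists_norm_le
    exact ⟨R, fun z hz h => absurd (hR z h) (not_le.2 hz)⟩
  set e : ℝ → ℂ := fun θ => Real.cos θ + Real.sin θ * Complex.I with he
  have hen : ∀ θ, ‖e θ‖ = 1 := fun θ => by
    simp only [he]
    rw [Complex.ofReal_cos, Complex.ofReal_sin, ← Complex.exp_mul_I, Complex.norm_exp_ofReal_mul_I]
  have hed : ∀ θ, HasDerivAt e (Complex.I * e θ) θ := fun θ => by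
    have h1 : e = fun θ : ℝ => Complex.exp (θ * Complex.I) := by
      ext θ; simp only [he]; rw [Complex.ofReal_cos, Complex.ofReal_sin, ← Complex.exp_mul_I]
    rw [h1]
    have h2 : HasDerivAt (fun θ : ℝ => (θ : ℂ) * Complex.I) (1 * Complex.I) θ :=
      (Complex.ofRealCLM.hasDerivAt (x := θ)).mul_const _
    convert h2.cexp using 1
    ring
  have hec : Continuous e := by fun_prop
  set A : ℝ × ℝ → ℂ := fun p => fderiv ℝ Φ (p.1 * e p.2) (e p.2) with hA
  set B : ℝ × ℝ → ℂ := fun p => fderiv ℝ Φ (p.1 * e p.2) (Complex.I * e p.2) with hB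
  have hAc : Continuous A := by fun_prop
  have hBc : Continuous B := by fun_prop
  have hout : ∀ r θ : ℝ, 0 < r → R < r → fderiv ℝ Φ (r * e θ) = 0 := by
    intro r θ hr hrR
    by_contra h
    refine hR (r * e θ) ?_ (tsupport_fderiv_subset ℝ (subset_tsupport _ h))
    rw [norm_mul, hen, mul_one, Complex.norm_real, Real.norm_of_nonneg hr.le]
    exact hrR
  have hpolar : ∀ F : ℝ × ℝ → ℂ, Continuous F →
      (∀ r θ : ℝ, 0 < r → R < r → F (r, θ) = 0) →
      IntegrableOn F (Set.Ioi 0 ×ˢ Set.Ioo (-Real.pi) Real.pi) := by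
    intro F hF hF0
    have h1 : IntegrableOn F (Set.Icc 0 R ×ˢ Set.Icc (-Real.pi) Real.pi) :=
      hF.continuousOn.integrableOn_compact (isCompact_Icc.prod isCompact_Icc)
    refine h1.of_forall_sdiff_eq_zero (measurableSet_Ioi.prod measurableSet_Ioo) ?_
    rintro ⟨r, θ⟩ ⟨⟨hr, hθ⟩, hn⟩
    refine hF0 r θ hr ?_
    by_contra hcon
    exact hn ⟨⟨le_of_lt hr, not_lt.1 hcon⟩, Set.Ioo_subset_Icc_self hθ⟩
  have hAi := hpolar A hAc fun r θ h1 h2 => by simp [hA, hout r θ h1 h2]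
  have hBi := hpolar B hBc fun r θ h1 h2 => by simp [hB, hout r θ h1 h2]
  have hAint : ∫ p in Set.Ioi 0 ×ˢ Set.Ioo (-Real.pi) Real.pi, A p = -(2 * Real.pi) * Φ 0 := by
    rw [Measure.volume_eq_prod, ← setIntegral_prod_swap,
      setIntegral_prod _ (by rw [Measure.volume_eq_prod] at hAi; exact hAi.swap)]
    have h1 : ∀ θ : ℝ, ∫ r in Set.Ioi (0 : ℝ), A (r, θ) = - Φ 0 := by
      intro θ
      have h2 : ∀ r : ℝ, HasDerivAt (fun r : ℝ => Φ (r * e θ)) (A (r, θ)) r := by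
        intro r
        have h3 : HasDerivAt (fun r : ℝ => (r : ℂ) * e θ) (1 * e θ) r :=
          (Complex.ofRealCLM.hasDerivAt (x := r)).mul_const _
        have h5 : HasDerivAt (fun r : ℝ => Φ (r * e θ)) (fderiv ℝ Φ (r * e θ) (1 * e θ)) r :=
          (hdiff (r * e θ)).hasFDerivAt.comp_hasDerivAt r h3
        rwa [one_mul] at h5
      have h4 : (fun r : ℝ => A (r, θ)) = deriv fun r : ℝ => Φ (r * e θ) := by
        ext r; rw [(h2 r).deriv]
      have h6 : ContDiff ℝ 1 fun r : ℝ => Φ (r * e θ) :=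
        hΦ.comp (Complex.ofRealCLM.contDiff.mul contDiff_const)
      rw [h4, HasCompactSupport.integral_Ioi_deriv_eq h6]
      · simp
      · refine HasCompactSupport.intro (isCompact_Icc (a := -|R|) (b := |R|)) fun r hr => ?_
        refine image_eq_zero_of_notMem_tsupport (hR _ ?_)
        rw [norm_mul, hen, mul_one, Complex.norm_real, Real.norm_eq_abs]
        by_contra hcon
        refine hr (abs_le.1 ((not_lt.1 hcon).trans (le_abs_self R)))
    simp only [Prod.swap, h1]
    rw [setIntegral_const]
    simp [Real.pi_pos.le, two_mul]
    ring
  have hBint : ∫ p in Set.Ioi 0 ×ˢ Set.Ioo (-Real.pi) Real.pi, B p = 0 := by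
    rw [Measure.volume_eq_prod, setIntegral_prod _ (by rwa [← Measure.volume_eq_prod])]
    refine setIntegral_eq_zero_of_forall_eq_zero fun r hr => ?_
    have hr0 : (r : ℂ) ≠ 0 := by exact_mod_cast (ne_of_gt hr : r ≠ 0)
    have h2 : ∀ θ : ℝ, HasDerivAt (fun θ : ℝ => (r : ℂ)⁻¹ * Φ (r * e θ)) (B (r, θ)) θ := by
      intro θ
      have h3 : HasDerivAt (fun θ : ℝ => (r : ℂ)⁻¹ * Φ (r * e θ))
          ((r : ℂ)⁻¹ * fderiv ℝ Φ (r * e θ) (r * (Complex.I * e θ))) θ :=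
        ((hdiff (r * e θ)).hasFDerivAt.comp_hasDerivAt θ
          ((hed θ).const_mul (r : ℂ))).const_mul ((r : ℂ)⁻¹)
      rwa [← Complex.real_smul (x := r) (z := Complex.I * e θ), map_smul, Complex.real_smul,
        inv_mul_cancel_left₀ hr0] at h3
    rw [← integral_Ioc_eq_integral_Ioo, ← intervalIntegral.integral_of_le (by linarith [Real.pi_pos])]
    rw [intervalIntegral.integral_eq_sub_of_hasDerivAt (fun θ _ => h2 θ)
      (by apply Continuous.intervalIntegrable; fun_prop)]
    simp [he]
  rw [← Complex.integral_comp_polarCoord_symm, polarCoord_target]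
  have : ∀ p ∈ (Set.Ioi (0 : ℝ) ×ˢ Set.Ioo (-Real.pi) Real.pi),
      p.1 • (dbar Φ (Complex.polarCoord.symm p) * (Complex.polarCoord.symm p)⁻¹)
        = 2⁻¹ * (A p + Complex.I * B p) := by
    rintro ⟨r, θ⟩ ⟨hr, hθ⟩
    have hr0 : (r : ℂ) ≠ 0 := by exact_mod_cast (ne_of_gt hr : r ≠ 0)
    have he0 : e θ ≠ 0 := norm_pos_iff.1 (by rw [hen]; norm_num)
    rw [Complex.polarCoord_symm_apply]
    simp only [hA, hB]
    change r • (dbar Φ (r * e θ) * (r * e θ)⁻¹) = _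
    set L := fderiv ℝ Φ (r * e θ) with hL
    have h1 : L (e θ) = Real.cos θ * L 1 + Real.sin θ * L Complex.I := by
      have : e θ = Real.cos θ • (1 : ℂ) + Real.sin θ • Complex.I := by
        simp [he]
      rw [this, map_add, map_smul, map_smul, Complex.real_smul, Complex.real_smul]
    have h2 : L (Complex.I * e θ) = -Real.sin θ * L 1 + Real.cos θ * L Complex.I := by
      have : Complex.I * e θ = (-Real.sin θ) • (1 : ℂ) + Real.cos θ • Complex.I := by
        simp only [he, Complex.real_smul]
        push_cast
        linear_combination (Complex.sin θ) * Complex.I_sq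
      rw [this, map_add, map_smul, map_smul, Complex.real_smul, Complex.real_smul]
      push_cast; ring
    rw [h1, h2]
    simp only [dbar, ← hL, Complex.real_smul]
    have h3 : e θ * (Real.cos θ - Real.sin θ * Complex.I) = 1 := by
      simp only [he]
      push_cast
      linear_combination Complex.sin_sq_add_cos_sq (θ : ℂ) - Complex.sin θ ^ 2 * Complex.I_sq
    have h4 : (e θ)⁻¹ = Real.cos θ - Real.sin θ * Complex.I := inv_eq_of_mul_eq_one_right h3
    rw [mul_inv, h4]
    field_simp
    linear_combination (-Real.sin θ * L Complex.I) * Complex.I_sq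
  rw [setIntegral_congr_fun (measurableSet_Ioi.prod measurableSet_Ioo) this, integral_const_mul,
    integral_add hAi (hBi.const_mul _), integral_const_mul, hAint, hBint]
  ring

theorem integral_dbar_mul_cauchyKernel {Φ : ℂ → ℂ} (hΦ : ContDiff ℝ 1 Φ)
    (hc : HasCompactSupport Φ) (z : ℂ) :
    ∫ ζ, dbar Φ ζ * (z - ζ)⁻¹ = Real.pi * Φ z := by
  have h := integral_dbar_mul_inv (Φ := fun ζ => Φ (ζ + z)) (hΦ.comp (by fun_prop))
    (hc.comp_homeomorph (Homeomorph.addRight z))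
  have h1 : ∀ ζ, dbar (fun ζ => Φ (ζ + z)) ζ = dbar Φ (ζ + z) := fun ζ => by
    simp only [dbar, fderiv_comp_add_right]
  simp only [h1, zero_add] at h
  rw [← integral_add_right_eq_self _ z, ← neg_neg (Real.pi * Φ z : ℂ), ← neg_mul, ← h,
    ← integral_neg]
  congr 1
  ext ζ
  rw [show z - (ζ + z) = -ζ by ring, inv_neg, mul_neg]

/-- A fixed smooth bump function supported in the closed unit disc. -/
def planeBump : ContDiffBump (0 : ℂ) := ⟨1 / 2, 1, by norm_num, by norm_num⟩

/-- The mollification of `f` at scale one. -/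
def mollify (f : ℂ → ℂ) : ℂ → ℂ :=
  convolution (planeBump.normed volume) f (ContinuousLinearMap.lsmul ℝ ℝ) volume

theorem contDiff_planeBump_normed : ContDiff ℝ 1 (planeBump.normed (volume : Measure ℂ)) :=
  planeBump.contDiff_normed (n := 1)

theorem contDiff_mollify {f : ℂ → ℂ} (hf : Continuous f) : ContDiff ℝ 1 (mollify f) :=
  HasCompactSupport.contDiff_convolution_left _ planeBump.hasCompactSupport_normed (n := 1)
    contDiff_planeBump_normed hf.locallyIntegrable

theorem planeBump_normed_eq_zero {t : ℂ} (ht : 1 ≤ ‖t‖) :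
    planeBump.normed (volume : Measure ℂ) t = 0 := by
  by_contra h
  have h1 : t ∈ Function.support (planeBump.normed (volume : Measure ℂ)) := h
  rw [planeBump.support_normed_eq, mem_ball_zero_iff] at h1
  exact absurd h1 (not_lt.2 ht)

theorem fderiv_planeBump_normed_eq_zero {t : ℂ} (ht : 1 < ‖t‖) :
    fderiv ℝ (planeBump.normed (volume : Measure ℂ)) t = 0 := by
  by_contra h
  have h1 : t ∈ tsupport (planeBump.normed (volume : Measure ℂ)) :=
    tsupport_fderiv_subset ℝ (subset_tsupport _ h)
  rw [planeBump.tsupport_normed_eq, mem_closedBall_zero_iff] at h1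
  exact absurd h1 (not_le.2 ht)

theorem norm_mollify_sub_le {f : ℂ → ℂ} (hf : Continuous f) {ε : ℝ}
    (h : ∀ z w, ‖z - w‖ ≤ 1 → ‖f z - f w‖ ≤ ε) (z : ℂ) : ‖mollify f z - f z‖ ≤ ε := by
  rw [← dist_eq_norm]
  refine planeBump.dist_normed_convolution_le hf.aestronglyMeasurable fun x hx => ?_
  rw [dist_eq_norm]
  refine h _ _ ?_
  rw [mem_ball, dist_eq_norm] at hx
  exact hx.le

theorem exists_norm_fderiv_mollify_le : ∃ M : ℝ, 0 ≤ M ∧ ∀ f : ℂ → ℂ, Continuous f → ∀ ε : ℝ,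
    (∀ z w, ‖z - w‖ ≤ 1 → ‖f z - f w‖ ≤ ε) → ∀ z, ‖fderiv ℝ (mollify f) z‖ ≤ M * ε := by
  set φ := planeBump.normed (volume : Measure ℂ) with hφ
  set L := ContinuousLinearMap.precompL ℂ (ContinuousLinearMap.lsmul ℝ ℝ : ℝ →L[ℝ] ℂ →L[ℝ] ℂ)
    with hL
  have hφ1 : ContDiff ℝ 1 φ := contDiff_planeBump_normed
  have hφc : HasCompactSupport φ := planeBump.hasCompactSupport_normed
  have hφi : Integrable fun t => ‖fderiv ℝ φ t‖ :=
    ((hφ1.continuous_fderiv (by norm_num)).integrable_of_hasCompactSupport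
      (hφc.fderiv (𝕜 := ℝ))).norm
  refine ⟨‖L‖ * ∫ t, ‖fderiv ℝ φ t‖, by positivity, fun f hf ε hε z => ?_⟩
  have hc : Continuous fun x => f x - f z := by fun_prop
  have h1 : mollify f = fun x =>
      convolution φ (fun x => f x - f z) (ContinuousLinearMap.lsmul ℝ ℝ) volume x + f z := by
    ext x
    have e1 := (hφc.convolutionExists_left (ContinuousLinearMap.lsmul ℝ ℝ) hφ1.continuous
      hc.locallyIntegrable (μ := volume) x).integrable
    have e2 : Integrable fun t => φ t • f z :=
      (hφ1.continuous.integrable_of_hasCompactSupport hφc).smul_const _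
    have e3 : ∫ t, φ t • f z = f z := by
      rw [integral_smul_const, planeBump.integral_normed, one_smul]
    rw [mollify, convolution_def, convolution_def]
    have e4 := integral_add e1 e2
    rw [e3] at e4
    rw [← e4]
    congr 1
    ext t
    rw [ContinuousLinearMap.lsmul_apply, ContinuousLinearMap.lsmul_apply, smul_sub,
      sub_add_cancel]
  have h2 := (hφc.hasFDerivAt_convolution_left (ContinuousLinearMap.lsmul ℝ ℝ) hφ1
    hc.locallyIntegrable (μ := volume) z).add_const (f z)
  rw [h1, h2.fderiv, convolution_def, mul_right_comm]
  calc _ ≤ ∫ t, ‖L‖ * ε * ‖fderiv ℝ φ t‖ := by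
        refine norm_integral_le_of_norm_le (hφi.const_mul _) (ae_of_all _ fun t => ?_)
        refine (L.le_opNorm₂ _ _).trans ?_
        rcases le_or_gt ‖t‖ 1 with ht | ht
        · rw [mul_right_comm]
          gcongr
          exact hε _ _ (by simpa using ht)
        · simp [hφ, fderiv_planeBump_normed_eq_zero ht]
    _ = ‖L‖ * ε * ∫ t, ‖fderiv ℝ φ t‖ := integral_const_mul _ _

theorem differentiableAt_mollify {f : ℂ → ℂ} (hf : Continuous f) {z : ℂ}
    (hd : DifferentiableOn ℂ f (ball z 2)) : DifferentiableAt ℂ (mollify f) z := by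
  set φ := planeBump.normed (volume : Measure ℂ) with hφ
  have hφ1 : Continuous φ := contDiff_planeBump_normed.continuous
  have hφc : HasCompactSupport φ := planeBump.hasCompactSupport_normed
  have hφi : Integrable φ := hφ1.integrable_of_hasCompactSupport hφc
  have hφ0 : ∀ t, 0 ≤ φ t := fun t => planeBump.nonneg_normed t
  have hdc : ContinuousOn (deriv f) (closedBall z (3 / 2)) :=
    ((hd.deriv isOpen_ball).continuousOn).mono (closedBall_subset_ball (by norm_num))
  obtain ⟨M, hM⟩ := (isCompact_closedBall z (3 / 2)).exists_bound_of_continuousOn hdc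
  have key := hasDerivAt_integral_of_dominated_loc_of_deriv_le (μ := volume) (𝕜 := ℂ)
    (F := fun x t => φ t • f (x - t)) (F' := fun x t => φ t • deriv f (x - t))
    (bound := fun t => φ t * M) (x₀ := z) (s := ball z (1 / 2)) (ball_mem_nhds _ (by norm_num))
    (Eventually.of_forall fun x => Continuous.aestronglyMeasurable (by fun_prop))
    (Continuous.integrable_of_hasCompactSupport (by fun_prop) (hφc.smul_right))
    (by
      have : Measurable fun t => φ t • deriv f (z - t) :=
        hφ1.measurable.smul ((measurable_deriv f).comp (by fun_prop))
      exact this.aestronglyMeasurable)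
    (ae_of_all _ fun t x hx => by
      rcases le_or_gt 1 ‖t‖ with ht | ht
      · simp [hφ, planeBump_normed_eq_zero ht]
      · rw [norm_smul, Real.norm_of_nonneg (hφ0 t)]
        refine mul_le_mul_of_nonneg_left (hM _ ?_) (hφ0 t)
        rw [mem_ball, dist_eq_norm] at hx
        rw [mem_closedBall, dist_eq_norm]
        have : x - t - z = (x - z) - t := by ring
        rw [this]
        exact (norm_sub_le _ _).trans (by linarith))
    (hφi.mul_const M)
    (ae_of_all _ fun t x hx => by
      rcases le_or_gt 1 ‖t‖ with ht | ht
      · simpa [hφ, planeBump_normed_eq_zero ht] using hasDerivAt_const x (0 : ℂ)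
      · have hmem : x - t ∈ ball z 2 := by
          rw [mem_ball, dist_eq_norm] at hx ⊢
          have : x - t - z = (x - z) - t := by ring
          rw [this]
          exact (norm_sub_le _ _).trans_lt (by linarith)
        have h1 := (hd.differentiableAt (isOpen_ball.mem_nhds hmem)).hasDerivAt
        exact (h1.comp_sub_const x t).const_smul (φ t))
  exact key.2.differentiableAt

/-- Vitushkin-type smoothing at scale one. -/
theorem exists_smoothing : ∃ M : ℝ, 0 ≤ M ∧ ∀ f : ℂ → ℂ, Continuous f → HasCompactSupport f →
    ∀ ε : ℝ, (∀ z w, ‖z - w‖ ≤ 1 → ‖f z - f w‖ ≤ ε) →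
    ∃ Φ : ℂ → ℂ, ContDiff ℝ 1 Φ ∧ HasCompactSupport Φ ∧ (∀ z, ‖Φ z - f z‖ ≤ ε) ∧
      (∀ z, ‖dbar Φ z‖ ≤ M * ε) ∧
      ∀ z, DifferentiableOn ℂ f (ball z 2) → dbar Φ z = 0 := by
  obtain ⟨M, hM0, hM⟩ := exists_norm_fderiv_mollify_le
  refine ⟨M, hM0, fun f hf hc ε hε => ⟨mollify f, contDiff_mollify hf, ?_,
    norm_mollify_sub_le hf hε, fun z => (norm_dbar_le _ _).trans (hM f hf ε hε z), fun z hz =>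
    dbar_eq_zero_of_differentiableAt (differentiableAt_mollify hf hz)⟩⟩
  exact planeBump.hasCompactSupport_normed.convolution _ hc

theorem integrable_mul_cauchyKernel {D : ℂ → ℂ} (hD : Continuous D) (hDc : HasCompactSupport D)
    (z : ℂ) : Integrable fun ζ => D ζ * (z - ζ)⁻¹ := by
  obtain ⟨M, hM⟩ := hD.bounded_above_of_compact_support hDc
  obtain ⟨R, hR⟩ := hDc.isCompact.isBounded.exists_norm_le
  have hM0 : 0 ≤ M := (norm_nonneg _).trans (hM 0)
  refine ((integrable_errKernel_sub z).const_mul (M * (1 + (‖z‖ + R) ^ 2))).mono'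
    (Measurable.aestronglyMeasurable (by fun_prop)) (ae_of_all _ fun ζ => ?_)
  by_cases hζ : D ζ = 0
  · rw [hζ, zero_mul, norm_zero]
    exact mul_nonneg (by positivity) (errKernel_nonneg _)
  · have h1 : ‖ζ‖ ≤ R := hR ζ (subset_tsupport _ hζ)
    have h2 : ‖z - ζ‖ ≤ ‖z‖ + R := (norm_sub_le _ _).trans (by gcongr)
    rw [norm_mul, norm_inv, mul_assoc]
    refine mul_le_mul (hM ζ) ?_ (by positivity) hM0
    rw [errKernel, mul_inv]
    have h3 : (1 + ‖z - ζ‖ ^ 2) * (1 + ‖z - ζ‖ ^ 2)⁻¹ = 1 := mul_inv_cancel₀ (by positivity)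
    calc ‖z - ζ‖⁻¹ = (1 + ‖z - ζ‖ ^ 2) * (‖z - ζ‖⁻¹ * (1 + ‖z - ζ‖ ^ 2)⁻¹) := by
          rw [mul_left_comm, h3, mul_one]
      _ ≤ _ := by gcongr

theorem integrable_mul_errKernel {D : ℂ → ℂ} (hD : Continuous D) (hDc : HasCompactSupport D)
    (z : ℂ) : Integrable fun ζ => ‖D ζ‖ * errKernel (z - ζ) := by
  obtain ⟨M, hM⟩ := hD.bounded_above_of_compact_support hDc
  refine ((integrable_errKernel_sub z).const_mul M).mono'
    (Measurable.aestronglyMeasurable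
      (hD.norm.measurable.mul (measurable_errKernel.comp (by fun_prop)))) (ae_of_all _ fun ζ => ?_)
  rw [norm_mul, norm_norm, Real.norm_of_nonneg (errKernel_nonneg _)]
  exact mul_le_mul_of_nonneg_right (hM ζ) (errKernel_nonneg _)

theorem exists_polyApprox_setIntegral_near {K : Set ℂ} (hK : IsCompact K)
    (hKc : IsPreconnected Kᶜ) {D : ℂ → ℂ} (hD : Continuous D) (hDc : HasCompactSupport D)
    {b : ℂ} (hb : b ∉ K) {X : Set ℂ} (hX : MeasurableSet X) (hXb : ∀ ζ ∈ X, ‖ζ - b‖ ≤ 4) :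
    ∃ G, PolyApprox K G ∧ ∀ z ∈ K, ‖G z - ∫ ζ in X, D ζ * (z - ζ)⁻¹‖
      ≤ 2 * 10 ^ 8 * ∫ ζ in X, ‖D ζ‖ * errKernel (z - ζ) := by
  obtain ⟨g, m, hg, hgm⟩ := exists_approx_cauchyKernel hK hKc hb
  have i1 : Integrable D := hD.integrable_of_hasCompactSupport hDc
  have i2 : Integrable fun ζ => D ζ * (ζ - m) :=
    Continuous.integrable_of_hasCompactSupport (by fun_prop) hDc.mul_right
  refine ⟨fun z => (∫ ζ in X, D ζ) * g z + (∫ ζ in X, D ζ * (ζ - m)) * (g z * g z),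
    (hg.const_mul hK _).add ((hg.mul hK hg).const_mul hK _), fun z hz => ?_⟩
  have e : (∫ ζ in X, D ζ) * g z + (∫ ζ in X, D ζ * (ζ - m)) * (g z * g z)
      - ∫ ζ in X, D ζ * (z - ζ)⁻¹
      = ∫ ζ in X, D ζ * (g z + (ζ - m) * g z ^ 2 - (z - ζ)⁻¹) := by
    have i3 : IntegrableOn (fun ζ => D ζ * g z + D ζ * (ζ - m) * (g z * g z)) X :=
      (i1.integrableOn.mul_const _).add (i2.integrableOn.mul_const _)
    rw [← integral_mul_const, ← integral_mul_const, ← integral_add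
      (i1.integrableOn.mul_const _) (i2.integrableOn.mul_const _), ← integral_sub i3
      (integrable_mul_cauchyKernel hD hDc z).integrableOn]
    congr 1
    ext ζ
    ring
  rw [e, ← integral_const_mul]
  refine norm_integral_le_of_norm_le
    ((integrable_mul_errKernel hD hDc z).integrableOn.const_mul _) ?_
  have hne : ∀ᵐ ζ ∂(volume.restrict X), ζ ≠ z :=
    ae_restrict_of_ae (by simp [ae_iff])
  filter_upwards [ae_restrict_mem hX, hne] with ζ hζ hζz
  rw [norm_mul, mul_left_comm]
  exact mul_le_mul_of_nonneg_left (hgm z hz ζ (hXb ζ hζ) hζz) (norm_nonneg _)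

theorem exists_polyApprox_integral {K : Set ℂ} (hK : IsCompact K)
    (hKc : IsPreconnected Kᶜ) {D : ℂ → ℂ} (hD : Continuous D) (hDc : HasCompactSupport D)
    (hDK : ∀ ζ, D ζ ≠ 0 → ∃ b, b ∉ K ∧ ‖ζ - b‖ < 2) :
    ∃ G, PolyApprox K G ∧ ∀ z ∈ K, ‖G z - ∫ ζ, D ζ * (z - ζ)⁻¹‖
      ≤ 2 * 10 ^ 8 * ∫ ζ, ‖D ζ‖ * errKernel (z - ζ) := by
  have key : ∃ s', MeasurableSet s' ∧ tsupport D ⊆ s' ∧ ∀ X, MeasurableSet X → X ⊆ s' →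
      ∃ G, PolyApprox K G ∧ ∀ z ∈ K, ‖G z - ∫ ζ in X, D ζ * (z - ζ)⁻¹‖
        ≤ 2 * 10 ^ 8 * ∫ ζ in X, ‖D ζ‖ * errKernel (z - ζ) := by
    refine hDc.isCompact.induction_on (p := fun s => ∃ s', MeasurableSet s' ∧ s ⊆ s' ∧
      ∀ X, MeasurableSet X → X ⊆ s' → ∃ G, PolyApprox K G ∧ ∀ z ∈ K,
        ‖G z - ∫ ζ in X, D ζ * (z - ζ)⁻¹‖
          ≤ 2 * 10 ^ 8 * ∫ ζ in X, ‖D ζ‖ * errKernel (z - ζ)) ?_ ?_ ?_ ?_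
    · refine ⟨∅, MeasurableSet.empty, subset_rfl, fun X _ hX => ⟨fun _ => 0, .const 0, ?_⟩⟩
      rw [Set.subset_empty_iff.1 hX]
      simp
    · rintro s t hst ⟨s', h1, h2, h3⟩
      exact ⟨s', h1, hst.trans h2, h3⟩
    · rintro s t ⟨s', hs1, hs2, hs3⟩ ⟨t', ht1, ht2, ht3⟩
      refine ⟨s' ∪ t', hs1.union ht1, Set.union_subset_union hs2 ht2, fun X hX hXst => ?_⟩
      obtain ⟨G, hG, hGz⟩ := hs3 (X ∩ s') (hX.inter hs1) Set.inter_subset_right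
      obtain ⟨H, hH, hHz⟩ := ht3 (X \ s') (hX.diff hs1) fun x hx => (hXst hx.1).resolve_left hx.2
      refine ⟨_, hG.add hH, fun z hz => ?_⟩
      rw [← integral_inter_add_sdiff hs1 (integrable_mul_cauchyKernel hD hDc z).integrableOn,
        ← integral_inter_add_sdiff hs1 (integrable_mul_errKernel hD hDc z).integrableOn,
        add_sub_add_comm, mul_add]
      exact (norm_add_le _ _).trans (add_le_add (hGz z hz) (hHz z hz))
    · intro x hx
      obtain ⟨ζ, hζ1, hζ2⟩ := Metric.mem_closure_iff.1 hx 1 one_pos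
      obtain ⟨b, hb, hζb⟩ := hDK ζ hζ1
      refine ⟨ball x 1, mem_nhdsWithin_of_mem_nhds (ball_mem_nhds x one_pos), ball x 1,
        measurableSet_ball, subset_rfl, fun X hX hXx => ?_⟩
      refine exists_polyApprox_setIntegral_near hK hKc hD hDc hb hX fun y hy => ?_
      have h1 := hXx hy
      rw [mem_ball, dist_eq_norm] at h1
      rw [dist_eq_norm] at hζ2
      calc ‖y - b‖ = ‖(y - x) + (x - ζ) + (ζ - b)‖ := by ring_nf
        _ ≤ ‖y - x‖ + ‖x - ζ‖ + ‖ζ - b‖ := norm_add₃_le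
        _ ≤ 4 := by linarith
  obtain ⟨s', hs1, hs2, hs3⟩ := key
  obtain ⟨G, hG, hGz⟩ := hs3 (tsupport D) (isClosed_tsupport D).measurableSet hs2
  refine ⟨G, hG, fun z hz => ?_⟩
  have h := hGz z hz
  rw [setIntegral_eq_integral_of_forall_compl_eq_zero,
    setIntegral_eq_integral_of_forall_compl_eq_zero] at h
  · exact h
  · intro ζ hζ
    rw [image_eq_zero_of_notMem_tsupport hζ, norm_zero, zero_mul]
  · intro ζ hζ
    rw [image_eq_zero_of_notMem_tsupport hζ, zero_mul]

theorem exists_polyApprox_of_oscillation_le : ∃ M : ℝ, 0 ≤ M ∧ ∀ K : Set ℂ, IsCompact K →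
    IsPreconnected Kᶜ → ∀ f : ℂ → ℂ, Continuous f → HasCompactSupport f →
    DifferentiableOn ℂ f (interior K) →
    ∀ ε : ℝ, (∀ z w, ‖z - w‖ ≤ 1 → ‖f z - f w‖ ≤ ε) →
    ∃ G, PolyApprox K G ∧ ∀ z ∈ K, ‖f z - G z‖ ≤ M * ε := by
  obtain ⟨M, hM0, hM⟩ := exists_smoothing
  set I := ∫ ζ, errKernel ζ with hI
  have hI0 : 0 ≤ I := integral_nonneg errKernel_nonneg
  refine ⟨1 + Real.pi⁻¹ * (2 * 10 ^ 8 * (M * I)), by positivity,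
    fun K hK hKc f hf hfc hfK ε hε => ?_⟩
  obtain ⟨Φ, hΦ, hΦc, hΦf, hΦd, hΦh⟩ := hM f hf hfc ε hε
  have hε0 : 0 ≤ ε := by simpa using hε 0 0 (by simp)
  have hD := continuous_dbar hΦ
  have hDc : HasCompactSupport (dbar Φ) :=
    hΦc.isCompact.of_isClosed_subset (isClosed_tsupport _) (tsupport_dbar_subset Φ)
  obtain ⟨G, hG, hGz⟩ := exists_polyApprox_integral hK hKc hD hDc fun ζ hζ => by
    by_contra! hcon
    refine hζ (hΦh ζ (hfK.mono (interior_maximal (fun b hb => ?_) isOpen_ball)))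
    by_contra hbK
    have := hcon b hbK
    rw [mem_ball, dist_eq_norm, norm_sub_rev] at hb
    linarith
  refine ⟨_, hG.const_mul hK (Real.pi : ℂ)⁻¹, fun z hz => ?_⟩
  have h1 := hGz z hz
  rw [integral_dbar_mul_cauchyKernel hΦ hΦc] at h1
  have h2 : ∫ ζ, ‖dbar Φ ζ‖ * errKernel (z - ζ) ≤ M * ε * I := by
    rw [hI, ← integral_sub_left_eq_self errKernel volume z, ← integral_const_mul]
    refine integral_mono (integrable_mul_errKernel hD hDc z)
      ((integrable_errKernel_sub z).const_mul _) fun ζ =>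
      mul_le_mul_of_nonneg_right (hΦd ζ) (errKernel_nonneg _)
  have hpi : (Real.pi : ℂ) ≠ 0 := by exact_mod_cast Real.pi_ne_zero
  have h3 : f z - (Real.pi : ℂ)⁻¹ * G z = -(Φ z - f z) - (Real.pi : ℂ)⁻¹ * (G z - Real.pi * Φ z) := by
    field_simp
    ring
  have h4 : ‖(Real.pi : ℂ)⁻¹ * (G z - Real.pi * Φ z)‖ ≤ Real.pi⁻¹ * (2 * 10 ^ 8 * (M * ε * I)) := by
    rw [norm_mul, norm_inv, Complex.norm_real, Real.norm_of_nonneg Real.pi_pos.le]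
    gcongr
    exact h1.trans (by gcongr)
  rw [h3]
  calc _ ≤ ε + Real.pi⁻¹ * (2 * 10 ^ 8 * (M * ε * I)) := by
        refine (norm_sub_le _ _).trans (add_le_add ?_ h4)
        rw [norm_neg]
        exact hΦf z
    _ = _ := by ring

theorem exists_compactSupport_extension {K : Set ℂ} (hK : IsCompact K) {h : ℂ → ℂ}
    (hc : ContinuousOn h K) : ∃ F : ℂ → ℂ, Continuous F ∧ HasCompactSupport F ∧ Set.EqOn F h K := by
  obtain ⟨g, hg⟩ := ContinuousMap.exists_restrict_eq hK.isClosed ⟨K.domRestrict h, hc.domRestrict⟩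
  obtain ⟨R, hR⟩ := hK.isBounded.exists_norm_le
  let χ : ContDiffBump (0 : ℂ) := ⟨|R| + 1, |R| + 2, by positivity, by linarith⟩
  refine ⟨fun z => χ z • g z, χ.continuous.smul g.continuous, χ.hasCompactSupport.smul_right,
    fun z hz => ?_⟩
  have h1 : χ z = 1 := χ.one_of_mem_closedBall (by
    rw [mem_closedBall_zero_iff]
    exact (hR z hz).trans ((le_abs_self R).trans (by simp [χ])))
  have h2 := DFunLike.congr_fun hg ⟨z, hz⟩
  simp only [h1, one_smul]
  exact h2

/-- **Mergelyan's theorem.** -/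
theorem polyApprox_of_differentiableOn_interior {K : Set ℂ} (hK : IsCompact K)
    (hKc : IsPreconnected Kᶜ) {h : ℂ → ℂ} (hc : ContinuousOn h K)
    (hd : DifferentiableOn ℂ h (interior K)) : PolyApprox K h := by
  obtain ⟨F, hF, hFc, hFK⟩ := exists_compactSupport_extension hK hc
  obtain ⟨M, hM0, hM⟩ := exists_polyApprox_of_oscillation_le
  have hFd : DifferentiableOn ℂ F (interior K) := hd.congr fun z hz => hFK (interior_subset hz)
  refine PolyApprox.of_forall_exists fun ε hε => ?_
  obtain ⟨δ, hδ, hFδ⟩ := Metric.uniformContinuous_iff.1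
    (hF.uniformContinuous_of_tendsto_cocompact hFc.is_zero_at_infty) (ε / (M + 1)) (by positivity)
  set d : ℝ := δ / 2 with hd2
  have hd0 : (d : ℂ) ≠ 0 := by exact_mod_cast (by positivity : d ≠ 0)
  let e : ℂ ≃ₜ ℂ := Homeomorph.mulLeft₀ (d : ℂ) hd0
  have he : ∀ z, e z = d * z := fun z => rfl
  obtain ⟨G, hG, hGz⟩ := hM (e ⁻¹' K) (e.isCompact_preimage.2 hK)
    (by rw [← Set.preimage_compl]; exact e.isPreconnected_preimage.2 hKc) (F ∘ e)
    (hF.comp e.continuous) (hFc.comp_homeomorph e)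
    (by
      rw [← e.preimage_interior]
      refine hFd.comp ?_ (Set.mapsTo_preimage _ _)
      exact (differentiable_id.const_mul (d : ℂ)).differentiableOn) (ε / (M + 1))
    (fun z w hzw => by
      rw [← dist_eq_norm]
      refine (hFδ ?_).le
      rw [he, he, dist_eq_norm, ← mul_sub, norm_mul, Complex.norm_real,
        Real.norm_of_nonneg (by positivity)]
      nlinarith)
  refine ⟨fun z => G ((d : ℂ)⁻¹ * z), fun η hη => ?_, fun z hz => ?_⟩
  · obtain ⟨p, hp⟩ := hG η hη
    refine ⟨p.comp (C (d : ℂ)⁻¹ * X), fun z hz => ?_⟩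
    have := hp ((d : ℂ)⁻¹ * z) (by simpa [he, hd0] using hz)
    simpa using this
  · have := hGz ((d : ℂ)⁻¹ * z) (by simpa [he, hd0] using hz)
    rw [Function.comp_apply, he, mul_inv_cancel_left₀ hd0, hFK hz] at this
    refine this.trans_lt ?_
    rw [mul_div_assoc', div_lt_iff₀ (by positivity)]
    linarith

end CauchyTransform

theorem PowerSeries.coeff_coe_mul_mk (Q : ℂ[X]) (a : ℕ → ℂ) (j : ℕ) :
    PowerSeries.coeff j ((Q : PowerSeries ℂ) * PowerSeries.mk a)
      = ∑ i ∈ Finset.range (j + 1), Q.coeff i * a (j - i) := by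
  rw [PowerSeries.coeff_mul]
  simp only [Polynomial.coeff_coe, PowerSeries.coeff_mk]
  exact Finset.Nat.sum_antidiagonal_eq_sum_range_succ (fun i k => Q.coeff i * a k) j

theorem isPade_iff {a : ℕ → ℂ} {m q : ℕ} {P Q : ℂ[X]} : IsPade a m q P Q ↔
    P.natDegree ≤ m ∧ Q.natDegree ≤ q ∧ IsCoprime P Q ∧ Q.coeff 0 = 1 ∧
      (PowerSeries.X : PowerSeries ℂ) ^ (m + q + 1) ∣
        (Q : PowerSeries ℂ) * PowerSeries.mk a - P := by
  simp only [IsPade, PowerSeries.X_pow_dvd_iff, map_sub, PowerSeries.coeff_coe_mul_mk,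
    Polynomial.coeff_coe, sub_eq_zero, Nat.lt_succ_iff]

/-- The Hankel matrix whose determinant is `hankelDet a m q`. -/
def hankelMatrix (a : ℕ → ℂ) (m q : ℕ) : Matrix (Fin q) (Fin q) ℂ :=
  Matrix.of fun i j : Fin q => acoefZ a ((m : ℤ) - q + 1 + i + j)

theorem det_hankelMatrix (a : ℕ → ℂ) (m q : ℕ) : (hankelMatrix a m q).det = hankelDet a m q := rfl

/-- The polynomial of degree at most `q` without constant term whose coefficients, listed from
the top degree downwards, are `y`. -/
def tailPoly {q : ℕ} (y : Fin q → ℂ) : ℂ[X] := ∑ s : Fin q, C (y s) * X ^ (q - (s : ℕ))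

theorem coeff_tailPoly {q : ℕ} (y : Fin q → ℂ) (t : ℕ) :
    (tailPoly y).coeff t = ∑ s : Fin q, if t = q - (s : ℕ) then y s else 0 := by
  simp [tailPoly, Polynomial.finsetSum_coeff, Polynomial.coeff_X_pow]

theorem coeff_zero_tailPoly {q : ℕ} (y : Fin q → ℂ) : (tailPoly y).coeff 0 = 0 := by
  rw [coeff_tailPoly]
  refine Finset.sum_eq_zero fun s _ => if_neg ?_
  have := s.2
  omega

theorem natDegree_tailPoly_le {q : ℕ} (y : Fin q → ℂ) : (tailPoly y).natDegree ≤ q :=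
  natDegree_sum_le_of_forall_le _ _ fun _ _ =>
    (natDegree_C_mul_X_pow_le _ _).trans (Nat.sub_le _ _)

theorem coeff_tailPoly_sub {q : ℕ} (y : Fin q → ℂ) (s : Fin q) :
    (tailPoly y).coeff (q - s) = y s := by
  rw [coeff_tailPoly, Finset.sum_eq_single s]
  · simp
  · intro b _ hb
    refine if_neg fun h => hb (Fin.ext ?_)
    have := s.2
    have := b.2
    omega
  · simp

theorem eq_tailPoly {q : ℕ} {Y : ℂ[X]} (hY : Y.natDegree ≤ q) (h0 : Y.coeff 0 = 0) :
    Y = tailPoly fun s : Fin q => Y.coeff (q - s) := by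
  ext t
  by_cases ht : t = 0
  · rw [ht, h0, coeff_zero_tailPoly]
  by_cases htq : t ≤ q
  · have := coeff_tailPoly_sub (fun s : Fin q => Y.coeff (q - s)) ⟨q - t, by omega⟩
    simp only [show q - (q - t) = t by omega] at this
    exact this.symm
  · rw [coeff_eq_zero_of_natDegree_lt (by omega),
      coeff_eq_zero_of_natDegree_lt ((natDegree_tailPoly_le _).trans_lt (not_le.1 htq))]

theorem coeff_tailPoly_mul_mk {q : ℕ} (y : Fin q → ℂ) (a : ℕ → ℂ) (m : ℕ) (i : Fin q) :
    PowerSeries.coeff (m + 1 + i) ((tailPoly y : PowerSeries ℂ) * PowerSeries.mk a)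
      = (hankelMatrix a m q).mulVec y i := by
  have h1 : ((tailPoly y : ℂ[X]) : PowerSeries ℂ)
      = ∑ s : Fin q, PowerSeries.C (y s) * PowerSeries.X ^ (q - (s : ℕ)) := by
    rw [tailPoly, ← Polynomial.coeToPowerSeries.ringHom_apply, map_sum]
    simp
  rw [h1, Finset.sum_mul, map_sum, Matrix.mulVec, dotProduct]
  refine Finset.sum_congr rfl fun s _ => ?_
  rw [mul_assoc, PowerSeries.coeff_C_mul, PowerSeries.coeff_X_pow_mul', mul_comm]
  congr 1
  have := s.2
  simp only [hankelMatrix, Matrix.of_apply, acoefZ, PowerSeries.coeff_mk]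
  by_cases h : q - (s : ℕ) ≤ m + 1 + i
  · rw [if_pos h, if_pos (by omega)]
    congr 1
    omega
  · rw [if_neg h, if_neg (by omega)]

/-- The coefficients of the Padé denominator, obtained from Cramer's rule. -/
def padeVec (a : ℕ → ℂ) (m q : ℕ) : Fin q → ℂ :=
  -((hankelDet a m q)⁻¹ •
    (hankelMatrix a m q).adjugate.mulVec fun i : Fin q => a (m + 1 + i))

/-- The Padé denominator of type `(m, q)` given by Cramer's rule. -/
def padeDen (a : ℕ → ℂ) (m q : ℕ) : ℂ[X] := 1 + tailPoly (padeVec a m q)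

/-- The numerator attached to `padeDen`. -/
def padeNum (a : ℕ → ℂ) (m q : ℕ) : ℂ[X] :=
  PowerSeries.trunc (m + 1) ((padeDen a m q : PowerSeries ℂ) * PowerSeries.mk a)

theorem hankelMatrix_mulVec_padeVec {a : ℕ → ℂ} {m q : ℕ} (h : hankelDet a m q ≠ 0) :
    (hankelMatrix a m q).mulVec (padeVec a m q) = -fun i : Fin q => a (m + 1 + i) := by
  rw [padeVec, Matrix.mulVec_neg, Matrix.mulVec_smul, Matrix.mulVec_mulVec, Matrix.mul_adjugate,
    Matrix.smul_mulVec, Matrix.one_mulVec, det_hankelMatrix, inv_smul_smul₀ h]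

theorem natDegree_padeDen_le (a : ℕ → ℂ) (m q : ℕ) : (padeDen a m q).natDegree ≤ q :=
  (natDegree_add_le _ _).trans (by simpa using natDegree_tailPoly_le _)

theorem coeff_zero_padeDen (a : ℕ → ℂ) (m q : ℕ) : (padeDen a m q).coeff 0 = 1 := by
  simp [padeDen, coeff_zero_tailPoly]

theorem natDegree_padeNum_le (a : ℕ → ℂ) (m q : ℕ) : (padeNum a m q).natDegree ≤ m :=
  Nat.lt_succ_iff.1 (PowerSeries.natDegree_trunc_lt _ _)

theorem eq_padeDen {a : ℕ → ℂ} {m q : ℕ} (h : hankelDet a m q ≠ 0) {Q : ℂ[X]}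
    (hQ : Q.natDegree ≤ q) (h0 : Q.coeff 0 = 1)
    (hQa : ∀ i : Fin q, PowerSeries.coeff (m + 1 + i)
      ((Q : PowerSeries ℂ) * PowerSeries.mk a) = 0) : Q = padeDen a m q := by
  have h1 : (Q - 1).natDegree ≤ q := (natDegree_sub_le _ _).trans (by simpa using hQ)
  have h2 := eq_tailPoly h1 (by simp [h0])
  set y : Fin q → ℂ := fun s => (Q - 1).coeff (q - s) with hy
  have h3 : (hankelMatrix a m q).mulVec y = -fun i : Fin q => a (m + 1 + i) := by
    ext i
    rw [← coeff_tailPoly_mul_mk, ← h2]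
    push_cast
    rw [sub_mul, map_sub, hQa, one_mul, PowerSeries.coeff_mk]
    simp
  have h4 : y = padeVec a m q := by
    rw [← sub_eq_zero]
    refine Matrix.eq_zero_of_mulVec_eq_zero (M := hankelMatrix a m q) h ?_
    rw [Matrix.mulVec_sub, h3, hankelMatrix_mulVec_padeVec h, sub_self]
  rw [padeDen, ← h4, ← h2]
  ring

theorem coeff_padeDen_mul_mk {a : ℕ → ℂ} {m q : ℕ} (h : hankelDet a m q ≠ 0) (i : Fin q) :
    PowerSeries.coeff (m + 1 + i) ((padeDen a m q : PowerSeries ℂ) * PowerSeries.mk a) = 0 := by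
  rw [padeDen]
  push_cast
  rw [add_mul, map_add, coeff_tailPoly_mul_mk, hankelMatrix_mulVec_padeVec h, one_mul,
    PowerSeries.coeff_mk]
  simp

theorem X_pow_dvd_mul_mk_sub {a : ℕ → ℂ} {m q : ℕ} {Q : ℂ[X]}
    (hQa : ∀ i : Fin q, PowerSeries.coeff (m + 1 + i)
      ((Q : PowerSeries ℂ) * PowerSeries.mk a) = 0) :
    (PowerSeries.X : PowerSeries ℂ) ^ (m + q + 1) ∣ (Q : PowerSeries ℂ) * PowerSeries.mk a
      - (PowerSeries.trunc (m + 1) ((Q : PowerSeries ℂ) * PowerSeries.mk a) : ℂ[X]) := by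
  rw [PowerSeries.X_pow_dvd_iff]
  intro j hj
  rw [map_sub, Polynomial.coeff_coe, PowerSeries.coeff_trunc]
  split_ifs with hjm
  · exact sub_self _
  · have := hQa ⟨j - (m + 1), by omega⟩
    simp only [show m + 1 + (j - (m + 1)) = j by omega] at this
    rw [this, sub_zero]

theorem isPade_padeNum_padeDen {a : ℕ → ℂ} {m q : ℕ} (h : hankelDet a m q ≠ 0) :
    IsPade a m q (padeNum a m q) (padeDen a m q) := by
  have hdvd : (PowerSeries.X : PowerSeries ℂ) ^ (m + q + 1) ∣
      (padeDen a m q : PowerSeries ℂ) * PowerSeries.mk a - (padeNum a m q : ℂ[X]) :=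
    X_pow_dvd_mul_mk_sub (coeff_padeDen_mul_mk h)
  refine isPade_iff.2 ⟨natDegree_padeNum_le _ _ _, natDegree_padeDen_le _ _ _, ?_,
    coeff_zero_padeDen _ _ _, hdvd⟩
  rw [isCoprime_iff_aeval_ne_zero_of_isAlgClosed ℂ ℂ]
  by_contra! hcon
  obtain ⟨ζ, hζ1, hζ2⟩ := hcon
  rw [aeval_def, eval₂_eq_eval_map, Algebra.algebraMap_self, Polynomial.map_id] at hζ1 hζ2
  obtain ⟨P1, hP1⟩ := dvd_iff_isRoot.2 hζ1
  obtain ⟨Q1, hQ1⟩ := dvd_iff_isRoot.2 hζ2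
  have h00 := coeff_zero_padeDen a m q
  rw [hQ1, mul_coeff_zero] at h00
  have hζ0 : ζ ≠ 0 := by
    rintro rfl
    simp at h00
  have hQ10 : Q1.coeff 0 ≠ 0 := right_ne_zero_of_mul_eq_one h00
  have hQ1ne : Q1 ≠ 0 := by
    rintro rfl
    simp at hQ10
  have hunit : IsUnit ((X - C ζ : ℂ[X]) : PowerSeries ℂ) := by
    rw [PowerSeries.isUnit_iff_constantCoeff]
    simp [hζ0]
  have hdvd1 : (PowerSeries.X : PowerSeries ℂ) ^ (m + q + 1) ∣
      (Q1 : PowerSeries ℂ) * PowerSeries.mk a - (P1 : ℂ[X]) := by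
    rw [← hunit.dvd_mul_left]
    convert hdvd using 1
    rw [hP1, hQ1]
    push_cast
    ring
  have hdegQ : Q1.natDegree + 1 = (padeDen a m q).natDegree := by
    rw [hQ1, natDegree_mul (X_sub_C_ne_zero ζ) hQ1ne, natDegree_X_sub_C, add_comm]
  have hP1m : P1.natDegree ≤ m := by
    rcases eq_or_ne P1 0 with rfl | hP10
    · simp
    · have := natDegree_padeNum_le a m q
      rw [hP1, natDegree_mul (X_sub_C_ne_zero ζ) hP10, natDegree_X_sub_C] at this
      omega
  have hQle := natDegree_padeDen_le a m q
  have h2 : C (Q1.coeff 0)⁻¹ * Q1 = padeDen a m q := by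
    refine eq_padeDen h ((natDegree_C_mul_le _ _).trans (by omega)) (by simp [hQ10]) fun i => ?_
    rw [PowerSeries.X_pow_dvd_iff] at hdvd1
    have h3 := hdvd1 (m + 1 + i) (by have := i.2; omega)
    rw [map_sub, Polynomial.coeff_coe, coeff_eq_zero_of_natDegree_lt (by omega), sub_zero] at h3
    push_cast
    rw [mul_assoc, PowerSeries.coeff_C_mul, h3, mul_zero]
  have := congr_arg natDegree h2
  rw [natDegree_C_mul (inv_ne_zero hQ10)] at this
  omega

theorem IsPade.hankelDet_ne_zero {a : ℕ → ℂ} {m q : ℕ} {P Q : ℂ[X]} (h : IsPade a m q P Q)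
    (hQ : Q.natDegree = q) : hankelDet a m q ≠ 0 := by
  intro hdet
  obtain ⟨hPm, -, hcop, hQ0, hdvd⟩ := isPade_iff.1 h
  obtain ⟨y, hy0, hy⟩ := Matrix.exists_mulVec_eq_zero_iff (M := hankelMatrix a m q).2 hdet
  have h1 := X_pow_dvd_mul_mk_sub (a := a) (m := m) (q := q) (Q := tailPoly y)
    fun i => by rw [coeff_tailPoly_mul_mk, hy]; rfl
  set B := PowerSeries.trunc (m + 1) ((tailPoly y : PowerSeries ℂ) * PowerSeries.mk a) with hB
  have hBm : B.natDegree ≤ m := Nat.lt_succ_iff.1 (PowerSeries.natDegree_trunc_lt _ _)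
  have hYq := natDegree_tailPoly_le y
  have h2 : (PowerSeries.X : PowerSeries ℂ) ^ (m + q + 1) ∣
      ((tailPoly y * P - B * Q : ℂ[X]) : PowerSeries ℂ) := by
    have := (h1.mul_left (Q : PowerSeries ℂ)).sub (hdvd.mul_left (tailPoly y : PowerSeries ℂ))
    convert this using 1
    push_cast
    ring
  have h3 : tailPoly y * P - B * Q = 0 := by
    ext j
    rw [coeff_zero]
    rcases lt_or_ge j (m + q + 1) with hj | hj
    · rw [← Polynomial.coeff_coe]
      exact PowerSeries.X_pow_dvd_iff.1 h2 j hj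
    · refine coeff_eq_zero_of_natDegree_lt (lt_of_le_of_lt ?_ hj)
      refine (natDegree_sub_le _ _).trans (max_le ?_ ?_)
      · exact natDegree_mul_le.trans (by omega)
      · exact natDegree_mul_le.trans (by omega)
  have h4 : Q ∣ tailPoly y := by
    refine hcop.symm.dvd_of_dvd_mul_right ?_
    rw [sub_eq_zero.1 h3]
    exact dvd_mul_left _ _
  obtain ⟨R, hR⟩ := h4
  have hRne : R ≠ 0 := by
    rintro rfl
    refine hy0 (funext fun s => ?_)
    rw [← coeff_tailPoly_sub y s, hR]
    simp
  have hQne : Q ≠ 0 := by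
    rintro rfl
    simp at hQ0
  have hdeg : R.natDegree = 0 := by
    have := congr_arg natDegree hR
    rw [natDegree_mul hQne hRne] at this
    omega
  have h5 := coeff_zero_tailPoly y
  rw [hR, mul_coeff_zero, hQ0, one_mul] at h5
  rw [eq_C_of_natDegree_eq_zero hdeg, h5, map_zero] at hRne
  exact hRne rfl

theorem IsPade.eq_padeDen {a : ℕ → ℂ} {m q : ℕ} {P Q : ℂ[X]} (h : IsPade a m q P Q)
    (hdet : hankelDet a m q ≠ 0) : Q = padeDen a m q := by
  obtain ⟨hPm, hQq, -, hQ0, hdvd⟩ := isPade_iff.1 h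
  refine _root_.eq_padeDen hdet hQq hQ0 fun i => ?_
  have := i.2
  have h1 := PowerSeries.X_pow_dvd_iff.1 hdvd (m + 1 + i) (by omega)
  rwa [map_sub, Polynomial.coeff_coe, coeff_eq_zero_of_natDegree_lt (n := m + 1 + i) (by omega),
    sub_zero] at h1

theorem IsPade.eq_padeNum {a : ℕ → ℂ} {m q : ℕ} {P Q : ℂ[X]} (h : IsPade a m q P Q)
    (hdet : hankelDet a m q ≠ 0) : P = padeNum a m q := by
  have hQ := h.eq_padeDen hdet
  obtain ⟨hPm, -, -, -, hrel⟩ := h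
  ext j
  rw [padeNum, PowerSeries.coeff_trunc, ← hQ, PowerSeries.coeff_coe_mul_mk]
  split_ifs with hj
  · exact (hrel j (by omega)).symm
  · exact coeff_eq_zero_of_natDegree_lt (by omega)

theorem continuous_acoefZ (k : ℤ) : Continuous fun a : ℕ → ℂ => acoefZ a k := by
  unfold acoefZ
  split_ifs <;> fun_prop

theorem continuous_hankelMatrix (m q : ℕ) : Continuous fun a : ℕ → ℂ => hankelMatrix a m q :=
  continuous_pi fun _ => continuous_pi fun _ => continuous_acoefZ _

theorem continuous_hankelDet (m q : ℕ) : Continuous fun a : ℕ → ℂ => hankelDet a m q :=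
  (continuous_hankelMatrix m q).matrix_det

theorem continuousAt_padeVec {a : ℕ → ℂ} {m q : ℕ} (h : hankelDet a m q ≠ 0) :
    ContinuousAt (fun a => padeVec a m q) a := by
  refine ContinuousAt.neg (ContinuousAt.smul ((continuous_hankelDet m q).continuousAt.inv₀ h) ?_)
  refine Continuous.continuousAt ?_
  exact (continuous_hankelMatrix m q).matrix_adjugate.matrix_mulVec (by fun_prop)

theorem continuousAt_coeff_padeDen {a : ℕ → ℂ} {m q : ℕ} (h : hankelDet a m q ≠ 0) (t : ℕ) :
    ContinuousAt (fun a => (padeDen a m q).coeff t) a := by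
  simp only [padeDen, coeff_add, coeff_tailPoly]
  refine continuousAt_const.add (tendsto_finsetSum _ fun s _ => ?_)
  split_ifs
  · exact continuousAt_pi.1 (continuousAt_padeVec h) s
  · exact tendsto_const_nhds

theorem continuousAt_coeff_padeNum {a : ℕ → ℂ} {m q : ℕ} (h : hankelDet a m q ≠ 0) (t : ℕ) :
    ContinuousAt (fun a => (padeNum a m q).coeff t) a := by
  simp only [padeNum, PowerSeries.coeff_trunc, PowerSeries.coeff_coe_mul_mk]
  split_ifs
  · exact tendsto_finsetSum _ fun i _ =>
      (continuousAt_coeff_padeDen h i).mul (continuous_apply _).continuousAt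
  · exact tendsto_const_nhds

/-- Joint continuity of the evaluation of a family of polynomials of bounded degree. -/
theorem continuousAt_eval_of_coeff {T : Type*} [TopologicalSpace T] {p : T → ℂ[X]} {n : ℕ} {t : T}
    (hn : ∀ s, (p s).natDegree ≤ n) (hp : ∀ k, ContinuousAt (fun s => (p s).coeff k) t) (z : ℂ) :
    ContinuousAt (fun x : T × ℂ => (p x.1).eval x.2) (t, z) := by
  have : (fun x : T × ℂ => (p x.1).eval x.2)
      = fun x => ∑ k ∈ Finset.range (n + 1), (p x.1).coeff k * x.2 ^ k := by
    ext x
    exact eval_eq_sum_range' (Nat.lt_succ_iff.2 (hn _)) _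
  rw [this]
  exact tendsto_finsetSum _ fun k _ =>
    (Tendsto.comp (hp k) (continuousAt_fst (p := (t, z)))).mul
      (continuousAt_snd.pow k)

theorem isOpen_unitD : IsOpen unitD := isOpen_ball

theorem zero_mem_unitD : (0 : ℂ) ∈ unitD := by simp [unitD]

theorem Hol.tendsto_nhds_iff {ι : Type*} {l : Filter ι} {F : ι → Hol unitD} {f : Hol unitD} :
    Tendsto F l (𝓝 f) ↔ TendstoLocallyUniformlyOn (fun i => (F i).1) f.1 l unitD := by
  rw [(Topology.IsInducing.mk (f := fun f : Hol unitD =>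
    UniformOnFun.ofFun {K : Set unitD | IsCompact K} fun z : unitD => f.1 z) rfl).tendsto_nhds_iff,
    UniformOnFun.tendsto_iff_tendstoUniformlyOn,
    tendstoLocallyUniformlyOn_iff_forall_isCompact isOpen_unitD]
  simp only [Metric.tendstoUniformlyOn_iff]
  constructor
  · intro h K hKD hK ε hε
    have hK' : IsCompact (((↑) : unitD → ℂ) ⁻¹' K) := by
      refine Topology.IsInducing.subtypeVal.isCompact_preimage' hK ?_
      simpa using hKD
    filter_upwards [h _ hK' ε hε] with i hi z hz
    exact hi ⟨z, hKD hz⟩ hz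
  · intro h K hK ε hε
    filter_upwards [h _ (by rintro _ ⟨z, -, rfl⟩; exact z.2) (hK.image continuous_subtype_val) ε hε]
      with i hi z hz
    exact hi z ⟨z, hz, rfl⟩

theorem Hol.continuousAt_eval {f : Hol unitD} {z : ℂ} (hz : z ∈ unitD) :
    ContinuousAt (fun x : Hol unitD × ℂ => x.1.1 x.2) (f, z) := by
  have h : TendstoLocallyUniformlyOn (fun g : Hol unitD => g.1) f.1 (𝓝 f) unitD :=
    Hol.tendsto_nhds_iff.1 tendsto_id
  rw [Metric.tendstoLocallyUniformlyOn_iff] at h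
  rw [Metric.continuousAt_iff']
  intro ε hε
  obtain ⟨t, ht, hev⟩ := h (ε / 2) (half_pos hε) z hz
  rw [isOpen_unitD.nhdsWithin_eq hz] at ht
  have hc : ContinuousAt f.1 z := (f.2.1.continuousOn).continuousAt (isOpen_unitD.mem_nhds hz)
  have hc' := Metric.continuousAt_iff'.1 hc (ε / 2) (half_pos hε)
  rw [nhds_prod_eq]
  filter_upwards [hev.prod_mk (inter_mem ht hc')] with x hx
  have h1 := hx.1 x.2 hx.2.1
  have h2 : dist (f.1 x.2) (f.1 z) < ε / 2 := hx.2.2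
  calc dist (x.1.1 x.2) (f.1 z) ≤ dist (x.1.1 x.2) (f.1 x.2) + dist (f.1 x.2) (f.1 z) :=
        dist_triangle _ _ _
    _ < ε := by rw [dist_comm (x.1.1 x.2)]; linarith

theorem tendstoLocallyUniformlyOn_iteratedDeriv {ι : Type*} {l : Filter ι} {F : ι → ℂ → ℂ}
    {f : ℂ → ℂ} {U : Set ℂ} (hU : IsOpen U) (h : TendstoLocallyUniformlyOn F f l U)
    (hF : ∀ i, DifferentiableOn ℂ (F i) U) (k : ℕ) :
    TendstoLocallyUniformlyOn (fun i => iteratedDeriv k (F i)) (iteratedDeriv k f) l U ∧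
      ∀ i, DifferentiableOn ℂ (iteratedDeriv k (F i)) U := by
  induction k with
  | zero => simpa using ⟨h, hF⟩
  | succ k ih =>
    simp only [iteratedDeriv_succ]
    exact ⟨ih.1.deriv (Eventually.of_forall ih.2) hU, fun i => (ih.2 i).deriv hU⟩

theorem Hol.continuous_tc : Continuous fun f : Hol unitD => tc f.1 := by
  refine continuous_pi fun k => continuous_iff_continuousAt.2 fun f => ?_
  have h : TendstoLocallyUniformlyOn (fun g : Hol unitD => g.1) f.1 (𝓝 f) unitD :=
    Hol.tendsto_nhds_iff.1 tendsto_id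
  have := ((tendstoLocallyUniformlyOn_iteratedDeriv isOpen_unitD h (fun g => g.2.1) k).1).tendsto_at
    zero_mem_unitD
  exact this.div_const _

theorem exists_subset_closedBall_of_isCompact {K : Set ℂ} (hK : IsCompact K) (hKD : K ⊆ unitD) :
    ∃ n : ℕ, K ⊆ closedBall 0 (1 - 1 / ((n : ℝ) + 1)) := by
  rcases K.eq_empty_or_nonempty with rfl | hne
  · exact ⟨0, Set.empty_subset _⟩
  obtain ⟨z, hz, hmax⟩ := hK.exists_isMaxOn hne continuous_norm.continuousOn
  have hz1 : ‖z‖ < 1 := by simpa [unitD] using hKD hz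
  obtain ⟨n, hn⟩ := exists_nat_one_div_lt (sub_pos.2 hz1)
  refine ⟨n, fun x hx => ?_⟩
  have : ‖x‖ ≤ ‖z‖ := hmax hx
  rw [mem_closedBall_zero_iff]
  linarith

theorem closedBall_subset_unitD (n : ℕ) :
    closedBall (0 : ℂ) (1 - 1 / ((n : ℝ) + 1)) ⊆ unitD :=
  closedBall_subset_ball (by have : 0 < 1 / ((n : ℝ) + 1) := by positivity
                             linarith)

open Classical in
instance Hol.instBaireSpace : BaireSpace (Hol unitD) := by
  let 𝔖 : Set (Set unitD) := {K | IsCompact K}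
  let ι : Hol unitD → UniformOnFun unitD ℂ 𝔖 :=
    fun f => UniformOnFun.ofFun 𝔖 fun z : unitD => f.1 z
  let u : UniformSpace (Hol unitD) := UniformSpace.comap ι inferInstance
  have hι : IsUniformInducing ι := ⟨rfl⟩
  have hcg : IsCountablyGenerated (uniformity (UniformOnFun unitD ℂ 𝔖)) := by
    refine UniformOnFun.isCountablyGenerated_uniformity 𝔖
      (t := fun n => ((↑) : unitD → ℂ) ⁻¹' closedBall 0 (1 - 1 / ((n : ℝ) + 1))) ?_ ?_ ?_
    · intro n
      refine Topology.IsInducing.subtypeVal.isCompact_preimage' (isCompact_closedBall _ _) ?_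
      simpa using closedBall_subset_unitD n
    · intro m n hmn
      refine Set.preimage_mono (closedBall_subset_closedBall ?_)
      gcongr
    · intro s hs
      obtain ⟨n, hn⟩ := exists_subset_closedBall_of_isCompact (K := (↑) '' s)
        (IsCompact.image hs continuous_subtype_val) (by rintro _ ⟨z, -, rfl⟩; exact z.2)
      exact ⟨n, Set.image_subset_iff.1 hn⟩
  have hcg' : IsCountablyGenerated (uniformity (Hol unitD)) :=
    Filter.comap.isCountablyGenerated _ _
  have hclosed : IsClosed (Set.range ι) := by
    rw [isClosed_iff_clusterPt]
    intro g hg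
    obtain ⟨l, hl⟩ : ∃ l : Filter (Hol unitD), l.NeBot ∧ Tendsto ι l (𝓝 g) := by
      refine ⟨comap ι (𝓝 g), ?_, tendsto_comap⟩
      rw [comap_neBot_iff_frequently]
      exact mem_closure_iff_frequently.1 (mem_closure_iff_clusterPt.2 hg)
    have := hl.1
    let G : ℂ → ℂ := fun z => if hz : z ∈ unitD then UniformOnFun.toFun 𝔖 g ⟨z, hz⟩ else 0
    have hG : TendstoLocallyUniformlyOn (fun f : Hol unitD => f.1) G l unitD := by
      rw [tendstoLocallyUniformlyOn_iff_forall_isCompact isOpen_unitD]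
      intro K hKD hK
      have hK' : IsCompact (((↑) : unitD → ℂ) ⁻¹' K) := by
        refine Topology.IsInducing.subtypeVal.isCompact_preimage' hK ?_
        simpa using hKD
      have := UniformOnFun.tendsto_iff_tendstoUniformlyOn.1 hl.2 _ hK'
      rw [Metric.tendstoUniformlyOn_iff] at this ⊢
      intro ε hε
      filter_upwards [this ε hε] with i hi z hz
      have := hi ⟨z, hKD hz⟩ hz
      simp only [G, hKD hz, dif_pos]
      exact this
    refine ⟨⟨G, hG.differentiableOn (Eventually.of_forall fun f => f.2.1) isOpen_unitD,
      fun z hz => by simp [G, hz]⟩, ?_⟩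
    apply (UniformOnFun.toFun 𝔖).injective
    funext z
    simp [ι, G]
  have : CompleteSpace (Hol unitD) := (completeSpace_iff_isComplete_range hι).2 hclosed.isComplete
  let := UniformSpace.pseudoMetricSpace (Hol unitD)
  have hB : @BaireSpace (Hol unitD) u.toTopologicalSpace := BaireSpace.of_completelyPseudoMetrizable
  exact hB

theorem isPreconnected_setOf_norm_mem {s : Set ℝ} (hs : IsPreconnected s) (h0 : ∀ r ∈ s, 0 ≤ r) :
    IsPreconnected {z : ℂ | ‖z‖ ∈ s} := by
  have h := (hs.prod (isPreconnected_univ (α := ℝ))).image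
    (fun x : ℝ × ℝ => (x.1 : ℂ) * Complex.exp (x.2 * Complex.I)) (by fun_prop)
  convert h using 1
  ext z
  simp only [Set.mem_ofPred_eq, Set.mem_image, Set.mem_prod, Set.mem_univ, and_true, Prod.exists]
  constructor
  · intro hz
    exact ⟨‖z‖, z.arg, hz, Complex.norm_mul_exp_arg_mul_I z⟩
  · rintro ⟨r, θ, hr, rfl⟩
    simpa [Complex.norm_exp_ofReal_mul_I, abs_of_nonneg (h0 r hr)] using hr

theorem isPreconnected_compl_union_closedBall {L : Set ℂ} (hLc : IsPreconnected Lᶜ)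
    (hL : IsClosed L) (hLD : Disjoint L unitD) {ρ : ℝ} (hρ0 : 0 ≤ ρ) (hρ : ρ < 1) :
    IsPreconnected (L ∪ closedBall 0 ρ)ᶜ := by
  have hA : IsPreconnected {z : ℂ | ‖z‖ ∈ Set.Ioo ρ 1} :=
    isPreconnected_setOf_norm_mem isPreconnected_Ioo fun r hr => hρ0.trans hr.1.le
  set U := (L ∪ closedBall (0 : ℂ) ρ)ᶜ with hU
  have hUo : IsOpen U := (hL.union isClosed_closedBall).isOpen_compl
  have hAU : {z : ℂ | ‖z‖ ∈ Set.Ioo ρ 1} ⊆ U := by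
    intro z hz
    have h1 : z ∈ unitD := by simpa [unitD] using hz.2
    rw [hU, Set.mem_compl_iff, Set.mem_union, not_or, mem_closedBall_zero_iff, not_le]
    exact ⟨fun h => Set.disjoint_left.1 hLD h h1, hz.1⟩
  have hDL : unitD ⊆ Lᶜ := fun z hz h => Set.disjoint_left.1 hLD h hz
  have hLU : ∀ z, z ∉ L → z ∈ U ∨ z ∈ unitD := by
    intro z hz
    by_cases h : z ∈ closedBall (0 : ℂ) ρ
    · exact Or.inr (closedBall_subset_ball hρ h)
    · exact Or.inl (by simp only [hU, Set.mem_compl_iff, Set.mem_union, not_or]; exact ⟨hz, h⟩)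
  have hUL : U ⊆ Lᶜ := fun z hz h => hz (Or.inl h)
  have hUD : ∀ z ∈ U, z ∈ unitD → ‖z‖ ∈ Set.Ioo ρ 1 := by
    intro z hz hzD
    refine ⟨?_, by simpa [unitD] using hzD⟩
    by_contra hc
    exact hz (Or.inr (by simpa using hc))
  have key : ∀ u v : Set ℂ, IsOpen u → IsOpen v → U ⊆ u ∪ v → U ∩ (u ∩ v) = ∅ →
      {z : ℂ | ‖z‖ ∈ Set.Ioo ρ 1} ⊆ u → U ⊆ u := by
    intro u v hu hv huv hd hAu
    have h0 : ∀ z ∈ U, z ∈ u → z ∉ v := fun z hz hzu hzv =>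
      (Set.mem_empty_iff_false z).1 (hd ▸ ⟨hz, hzu, hzv⟩)
    have hcov : Lᶜ ⊆ (u ∩ U ∪ unitD) ∪ v ∩ U := by
      intro z hz
      rcases hLU z hz with h | h
      · rcases huv h with h' | h'
        · exact Or.inl (Or.inl ⟨h', h⟩)
        · exact Or.inr ⟨h', h⟩
      · exact Or.inl (Or.inr h)
    have hdisj : Lᶜ ∩ ((u ∩ U ∪ unitD) ∩ (v ∩ U)) = ∅ := by
      refine Set.eq_empty_of_forall_notMem ?_
      rintro z ⟨-, ⟨h1, -⟩ | h1, h2, h3⟩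
      · exact h0 z h3 h1 h2
      · exact h0 z h3 (hAu (hUD z h3 h1)) h2
    rcases isPreconnected_iff_subset_of_disjoint.1 hLc (u ∩ U ∪ unitD) (v ∩ U)
      ((hu.inter hUo).union isOpen_unitD) (hv.inter hUo) hcov hdisj with h | h
    · intro z hz
      rcases h (hUL hz) with h | h
      · exact h.1
      · exact hAu (hUD z hz h)
    · exact absurd (h (hDL zero_mem_unitD)).2 (by simp [hU, hρ0])
  refine isPreconnected_iff_subset_of_disjoint.2 fun u v hu hv huv hd => ?_
  rcases isPreconnected_iff_subset_of_disjoint.1 hA u v hu hv (hAU.trans huv)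
    (Set.eq_empty_of_subset_empty fun z hz => hd ▸ ⟨hAU hz.1, hz.2⟩) with h | h
  · exact Or.inl (key u v hu hv huv hd h)
  · exact Or.inr (key v u hv hu (Set.union_comm u v ▸ huv) (Set.inter_comm u v ▸ hd) h)

/-- A countable family of compact subsets of the complement of the unit disc. -/
def exhaustingCompact (M : ℕ) (F : Finset (ℕ × ℕ)) : Set ℂ :=
  closedBall 0 M \ (unitD ∪ ⋃ x ∈ F, ball (TopologicalSpace.denseSeq ℂ x.1) (1 / ((x.2 : ℝ) + 1)))

theorem isCompact_exhaustingCompact (M : ℕ) (F : Finset (ℕ × ℕ)) :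
    IsCompact (exhaustingCompact M F) :=
  (isCompact_closedBall _ _).diff
    (isOpen_unitD.union (isOpen_biUnion fun _ _ => isOpen_ball))

theorem disjoint_exhaustingCompact (M : ℕ) (F : Finset (ℕ × ℕ)) :
    Disjoint (exhaustingCompact M F) unitD :=
  Set.disjoint_left.2 fun _ hz hzD => hz.2 (Or.inl hzD)

theorem exists_isCompact_isPreconnected_subset {U : Set ℂ} (hU : IsOpen U) (hc : IsConnected U)
    {a : ℂ} (ha : a ∈ U) {s : Set ℂ} (hs : s.Finite) (hsU : s ⊆ U) :
    ∃ T, IsCompact T ∧ IsPreconnected T ∧ a ∈ T ∧ s ⊆ T ∧ T ⊆ U := by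
  have hp := hU.isConnected_iff_isPathConnected.1 hc
  induction s, hs using Set.Finite.induction_on with
  | empty => exact ⟨{a}, isCompact_singleton, isPreconnected_singleton, rfl, Set.empty_subset _,
      Set.singleton_subset_iff.2 ha⟩
  | @insert b s _ _ ih =>
    obtain ⟨T, hT, hTc, haT, hsT, hTU⟩ := ih ((Set.subset_insert _ _).trans hsU)
    obtain ⟨γ, hγ⟩ := hp.joinedIn a ha b (hsU (Set.mem_insert _ _))
    refine ⟨T ∪ Set.range γ, hT.union (isCompact_range γ.continuous),
      hTc.union a haT ⟨0, γ.source⟩ (isPreconnected_range γ.continuous), Or.inl haT, ?_, ?_⟩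
    · refine Set.insert_subset (Or.inr ⟨1, γ.target⟩) fun x hx => Or.inl (hsT hx)
    · refine Set.union_subset hTU ?_
      rintro _ ⟨t, rfl⟩
      exact hγ t

theorem exists_exhaustingCompact {K : Set ℂ} (hK : IsCompact K) (hKD : Disjoint K unitD)
    (hKc : IsConnected Kᶜ) {s : Set ℂ} (hs : s.Finite) (hsK : Disjoint K s) :
    ∃ M F, K ⊆ exhaustingCompact M F ∧ IsPreconnected (exhaustingCompact M F)ᶜ ∧
      Disjoint s (exhaustingCompact M F) := by
  obtain ⟨R, hR⟩ := hK.isBounded.exists_norm_le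
  obtain ⟨M, hM⟩ := exists_nat_ge R
  have hKM : ∀ z ∈ K, ‖z‖ ≤ M := fun z hz => (hR z hz).trans hM
  set b : ℂ := (M : ℂ) + 1 with hb
  have hbn : ‖b‖ = M + 1 := by
    rw [hb, ← Nat.cast_succ, Complex.norm_natCast]
    simp
  have hbK : b ∈ Kᶜ := fun h => by linarith [hKM b h]
  have h0K : (0 : ℂ) ∈ Kᶜ := fun h => Set.disjoint_left.1 hKD h zero_mem_unitD
  obtain ⟨T, hT, hTc, h0T, hsT, hTU⟩ := exists_isCompact_isPreconnected_subset
    hK.isClosed.isOpen_compl hKc h0K (hs.insert b)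
    (Set.insert_subset hbK fun x hx h => Set.disjoint_left.1 hsK h hx)
  have hbT : b ∈ T := hsT (Set.mem_insert _ _)
  have hball : ∀ x ∈ T, ∃ y : ℕ × ℕ, x ∈ ball (TopologicalSpace.denseSeq ℂ y.1) (1 / ((y.2 : ℝ) + 1)) ∧
      ball (TopologicalSpace.denseSeq ℂ y.1) (1 / ((y.2 : ℝ) + 1)) ⊆ Kᶜ := by
    intro x hx
    obtain ⟨r, hr, hrK⟩ := Metric.isOpen_iff.1 hK.isClosed.isOpen_compl x (hTU hx)
    obtain ⟨k, hk⟩ := exists_nat_one_div_lt (half_pos hr)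
    have hk0 : 0 < 1 / ((k : ℝ) + 1) := by positivity
    obtain ⟨j, hj⟩ := (TopologicalSpace.denseRange_denseSeq ℂ).exists_dist_lt x hk0
    refine ⟨(j, k), hj, fun z hz => hrK ?_⟩
    rw [mem_ball] at hz ⊢
    calc dist z x ≤ dist z (TopologicalSpace.denseSeq ℂ j) + dist x (TopologicalSpace.denseSeq ℂ j) := dist_triangle_right _ _ _
      _ < r := by simp only at hz; linarith
  choose! y hy1 hy2 using hball
  obtain ⟨t, htT, htc⟩ := hT.elim_nhds_subcover
    (fun x => ball (TopologicalSpace.denseSeq ℂ (y x).1) (1 / (((y x).2 : ℝ) + 1)))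
    fun x hx => isOpen_ball.mem_nhds (hy1 x hx)
  classical
  have hTF : T ⊆ (exhaustingCompact M (t.image y))ᶜ := by
    intro x hx h
    obtain ⟨i, hi, hxi⟩ := Set.mem_iUnion₂.1 (htc hx)
    exact h.2 (Or.inr (Set.mem_iUnion₂.2 ⟨y i, Finset.mem_image_of_mem y hi, hxi⟩))
  refine ⟨M, t.image y, fun z hz => ⟨by simpa using hKM z hz, ?_⟩, ?_, ?_⟩
  · rintro (h | h)
    · exact Set.disjoint_left.1 hKD hz h
    · obtain ⟨i, hi, hzi⟩ := Set.mem_iUnion₂.1 h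
      obtain ⟨x, hx, rfl⟩ := Finset.mem_image.1 hi
      exact hy2 x (htT x hx) hzi hz
  · refine isPreconnected_of_forall 0 fun z hz => ?_
    have step : ∀ S : Set ℂ, IsPreconnected S → (T ∩ S).Nonempty → z ∈ S →
        S ⊆ (exhaustingCompact M (t.image y))ᶜ →
        ∃ A ⊆ (exhaustingCompact M (t.image y))ᶜ, 0 ∈ A ∧ z ∈ A ∧ IsPreconnected A :=
      fun S hS ⟨x, hxT, hxS⟩ hzS hSL => ⟨T ∪ S, Set.union_subset hTF hSL, Or.inl h0T,
        Or.inr hzS, hTc.union x hxT hxS hS⟩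
    by_cases hzM : z ∈ closedBall (0 : ℂ) M
    · have hz' : z ∈ unitD ∪ ⋃ x ∈ t.image y, ball (TopologicalSpace.denseSeq ℂ x.1) (1 / ((x.2 : ℝ) + 1)) := by
        by_contra h
        exact hz ⟨hzM, h⟩
      rcases hz' with h | h
      · exact step unitD (convex_ball 0 1).isPreconnected ⟨0, h0T, zero_mem_unitD⟩ h
          fun x hx h => h.2 (Or.inl hx)
      · obtain ⟨i, hi, hzi⟩ := Set.mem_iUnion₂.1 h
        obtain ⟨x, hx, rfl⟩ := Finset.mem_image.1 hi
        exact step _ (convex_ball _ _).isPreconnected ⟨x, htT x hx, hy1 x (htT x hx)⟩ hzi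
          fun a ha h => h.2 (Or.inr (Set.mem_iUnion₂.2 ⟨y x, hi, ha⟩))
    · refine step {z : ℂ | ‖z‖ ∈ Set.Ioi (M : ℝ)} (isPreconnected_setOf_norm_mem isPreconnected_Ioi
        fun r hr => (Nat.cast_nonneg M).trans hr.le) ⟨b, hbT, ?_⟩ ?_ ?_
      · simp [hbn]
      · simpa using hzM
      · intro a ha h
        have h1 : ‖a‖ ≤ M := by simpa using h.1
        exact absurd ha (not_lt.2 h1)
  · exact Set.disjoint_left.2 fun x hx h => hTF (hsT (Set.mem_insert_of_mem _ hx)) h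

theorem tc_congr {f g : ℂ → ℂ} (h : f =ᶠ[𝓝 0] g) (k : ℕ) : tc f k = tc g k := by
  rw [tc, tc, h.iteratedDeriv_eq]

theorem tc_mul {f g : ℂ → ℂ} (hf : AnalyticAt ℂ f 0) (hg : AnalyticAt ℂ g 0) (j : ℕ) :
    tc (f * g) j = ∑ i ∈ Finset.range (j + 1), tc f i * tc g (j - i) := by
  rw [tc, iteratedDeriv_mul hf.contDiffAt hg.contDiffAt, Finset.sum_div]
  refine Finset.sum_congr rfl fun i hi => ?_
  rw [Nat.cast_choose _ (by grind), tc, tc]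
  field_simp [Nat.factorial_ne_zero]

theorem iteratedDeriv_polynomial_eval (p : ℂ[X]) (k : ℕ) :
    iteratedDeriv k (fun z => p.eval z) = fun z => (derivative^[k] p).eval z := by
  induction k with
  | zero => simp
  | succ k ih =>
    rw [iteratedDeriv_succ, ih, Function.iterate_succ_apply']
    ext z
    exact Polynomial.deriv _

theorem tc_polynomial (p : ℂ[X]) (k : ℕ) : tc (fun z => p.eval z) k = p.coeff k := by
  rw [tc, iteratedDeriv_polynomial_eval]
  beta_reduce
  rw [← Polynomial.coeff_zero_eq_eval_zero,
    Polynomial.coeff_iterate_derivative]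
  simp only [zero_add, Nat.descFactorial_self, nsmul_eq_mul]
  field_simp [Nat.factorial_ne_zero]

theorem sum_coeff_mul_tc {f : ℂ → ℂ} {P Q : ℂ[X]} (hf : DifferentiableOn ℂ f unitD)
    (h : ∀ z ∈ unitD, P.eval z = f z * Q.eval z) (j : ℕ) :
    ∑ i ∈ Finset.range (j + 1), Q.coeff i * tc f (j - i) = P.coeff j := by
  have hD : unitD ∈ 𝓝 (0 : ℂ) := isOpen_unitD.mem_nhds zero_mem_unitD
  have hfa : AnalyticAt ℂ f 0 := hf.analyticAt hD
  have hQa : AnalyticAt ℂ (fun z => Q.eval z) 0 := by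
    simpa using AnalyticAt.aeval_polynomial (analyticAt_id (𝕜 := ℂ) (z := (0 : ℂ))) Q
  rw [← tc_polynomial, tc_congr (g := (fun z => Q.eval z) * f), tc_mul hQa hfa]
  · simp only [tc_polynomial]
  · filter_upwards [hD] with z hz
    rw [Pi.mul_apply, mul_comm, h z hz]

/-- The polynomial with roots `w i` and constant coefficient `1`. -/
def rootPoly {q : ℕ} (w : Fin q → ℂ) : ℂ[X] := ∏ i, (1 - C (w i)⁻¹ * X)

section rootPoly
variable {q : ℕ} {w : Fin q → ℂ}

theorem eval_rootPoly (z : ℂ) : (rootPoly w).eval z = ∏ i, (1 - (w i)⁻¹ * z) := by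
  simp [rootPoly, eval_prod]

theorem eval_rootPoly_eq_zero_iff (hw : ∀ i, w i ≠ 0) {z : ℂ} :
    (rootPoly w).eval z = 0 ↔ ∃ i, z = w i := by
  rw [eval_rootPoly, Finset.prod_eq_zero_iff]
  refine ⟨fun ⟨i, _, hi⟩ => ⟨i, ?_⟩, fun ⟨i, hi⟩ => ⟨i, mem_univ i, ?_⟩⟩
  · have := hw i
    field_simp at hi
    linear_combination -hi
  · rw [hi, inv_mul_cancel₀ (hw i), sub_self]

theorem coeff_zero_rootPoly : (rootPoly w).coeff 0 = 1 := by
  simp [coeff_zero_eq_eval_zero, eval_rootPoly]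

theorem natDegree_rootPoly (hw : ∀ i, w i ≠ 0) : (rootPoly w).natDegree = q := by
  have h : ∀ i, (1 - C (w i)⁻¹ * X : ℂ[X]).natDegree = 1 := by
    intro i
    have : (1 - C (w i)⁻¹ * X : ℂ[X]) = C (-(w i)⁻¹) * X + C 1 := by
      simp only [C_neg, map_one]
      ring
    rw [this, natDegree_linear (neg_ne_zero.2 (inv_ne_zero (hw i)))]
  rw [rootPoly, natDegree_prod _ _ fun i _ h0 => by simpa [h0] using h i]
  simp [h]

theorem rootPoly_ne_zero : rootPoly w ≠ 0 := fun h => by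
  simpa [h] using coeff_zero_rootPoly (w := w)

theorem isCoprime_rootPoly (hw : ∀ i, w i ≠ 0) {A : ℂ[X]} (hA : ∀ i, A.eval (w i) ≠ 0) :
    IsCoprime A (rootPoly w) := by
  rw [Polynomial.isCoprime_iff_aeval_ne_zero_of_isAlgClosed ℂ ℂ]
  intro z
  by_cases hz : ∃ i, z = w i
  · obtain ⟨i, rfl⟩ := hz
    exact Or.inl (by simpa using hA i)
  · exact Or.inr (by simpa using fun h => hz ((eval_rootPoly_eq_zero_iff hw).1 h))

end rootPoly

theorem exists_norm_lt_forall_add_ne_zero {q : ℕ} (b : Fin q → ℂ) {ε : ℝ} (hε : 0 < ε) :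
    ∃ c : ℂ, ‖c‖ < ε ∧ ∀ i, b i + c ≠ 0 := by
  have hinf : (ball (0 : ℂ) ε).Infinite := infinite_of_mem_nhds 0 (ball_mem_nhds _ hε)
  obtain ⟨c, hc, hcb⟩ := hinf.exists_notMem_finset (Finset.univ.image fun i => -b i)
  refine ⟨c, by simpa using hc, fun i hi => hcb ?_⟩
  exact Finset.mem_image.2 ⟨i, mem_univ i, (eq_neg_of_add_eq_zero_right hi).symm⟩

theorem exists_polynomial_near {L : Set ℂ} (hL : IsCompact L) (hLD : Disjoint L unitD)
    (hLc : IsPreconnected Lᶜ) {f g : ℂ → ℂ} (hf : DifferentiableOn ℂ f unitD)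
    (hg : Differentiable ℂ g) {ρ : ℝ} (hρ0 : 0 ≤ ρ) (hρ : ρ < 1) {ε : ℝ} (hε : 0 < ε) :
    ∃ A : ℂ[X], (∀ z ∈ L, ‖A.eval z - g z‖ < ε) ∧
      ∀ z ∈ closedBall (0 : ℂ) ρ, ‖A.eval z - f z‖ < ε := by
  classical
  let F : ℂ → ℂ := fun z => if z ∈ unitD then f z else g z
  have hBD : closedBall (0 : ℂ) ρ ⊆ unitD := closedBall_subset_ball hρ
  have hFf : Set.EqOn F f unitD := fun z hz => if_pos hz
  have hFg : Set.EqOn F g unitDᶜ := fun z hz => if_neg hz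
  have hLD' : L ⊆ unitDᶜ := fun z hz h => Set.disjoint_left.1 hLD hz h
  have hcont : ContinuousOn F (L ∪ closedBall 0 ρ) :=
    ((hg.continuous.continuousOn).congr (hFg.mono hLD')).union_of_isClosed
      ((hf.continuousOn.mono hBD).congr (hFf.mono hBD)) hL.isClosed isClosed_closedBall
  have hdiff : DifferentiableOn ℂ F (interior (L ∪ closedBall 0 ρ)) := by
    intro z hz
    refine DifferentiableAt.differentiableWithinAt ?_
    by_cases hzD : z ∈ unitD
    · have hD := isOpen_unitD.mem_nhds hzD
      exact (hf.differentiableAt hD).congr_of_eventuallyEq (hFf.eventuallyEq_of_mem hD)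
    · refine (hg z).congr_of_eventuallyEq ?_
      filter_upwards [mem_interior_iff_mem_nhds.1 hz,
        isClosed_closedBall.isOpen_compl.mem_nhds fun h => hzD (hBD h)] with y hy1 hy2
      exact hFg (hLD' (hy1.resolve_right hy2))
  obtain ⟨A, hA⟩ := polyApprox_of_differentiableOn_interior
    (hL.union (isCompact_closedBall (0 : ℂ) ρ))
    (isPreconnected_compl_union_closedBall hLc hL.isClosed hLD hρ0 hρ) hcont hdiff ε hε
  refine ⟨A, fun z hz => ?_, fun z hz => ?_⟩
  · rw [norm_sub_rev, ← hFg (hLD' hz)]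
    exact hA z (Or.inl hz)
  · rw [norm_sub_rev, ← hFf (hBD hz)]
    exact hA z (Or.inr hz)

theorem exists_hol_isPade_rootPoly {q : ℕ} {w : Fin q → ℂ} (hw : ∀ i, 1 < ‖w i‖) {L : Set ℂ}
    (hL : IsCompact L) (hLD : Disjoint L unitD) (hLc : IsPreconnected Lᶜ) (p : ℂ[X]) {f₀ : ℂ → ℂ}
    (hf₀ : DifferentiableOn ℂ f₀ unitD) {ρ : ℝ} (hρ0 : 0 ≤ ρ) (hρ : ρ < 1) {ε : ℝ} (hε : 0 < ε) :
    ∃ (f : Hol unitD) (A : ℂ[X]), (∀ m ≥ A.natDegree, IsPade (tc f.1) m q A (rootPoly w)) ∧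
      (∀ z ∈ unitD, A.eval z = f.1 z * (rootPoly w).eval z) ∧
      (∀ z ∈ L, ‖A.eval z - p.eval z * (rootPoly w).eval z‖ < ε) ∧
      ∀ z ∈ closedBall (0 : ℂ) ρ, ‖f.1 z - f₀ z‖ < ε := by
  classical
  set Q := rootPoly w with hQ
  have hw0 : ∀ i, w i ≠ 0 := fun i h => by
    have := hw i
    rw [h, norm_zero] at this
    linarith
  have hBD : closedBall (0 : ℂ) ρ ⊆ unitD := closedBall_subset_ball hρ
  have hQ0 : ∀ z ∈ unitD, Q.eval z ≠ 0 := by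
    intro z hz h
    obtain ⟨i, rfl⟩ := (eval_rootPoly_eq_zero_iff hw0).1 h
    have h1 : ‖w i‖ < 1 := by simpa [unitD] using hz
    exact absurd (hw i) h1.not_gt
  obtain ⟨c, hc0, hc⟩ : ∃ c > 0, ∀ z ∈ closedBall (0 : ℂ) ρ, c ≤ ‖Q.eval z‖ :=
    (isCompact_closedBall (0 : ℂ) ρ).exists_forall_le' (f := fun z => ‖Q.eval z‖)
      (by fun_prop) fun z hz => norm_pos_iff.2 (hQ0 z (hBD hz))
  set δ := min ε (ε * c) / 2 with hδ
  have hδ0 : 0 < δ := by positivity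
  have hδ1 : δ + δ ≤ ε := by rw [hδ, add_halves]; exact min_le_left _ _
  have hδ2 : δ + δ ≤ ε * c := by rw [hδ, add_halves]; exact min_le_right _ _
  obtain ⟨A₀, hA1, hA2⟩ := exists_polynomial_near hL hLD hLc
    (f := fun z => f₀ z * Q.eval z) (g := fun z => p.eval z * Q.eval z)
    (hf₀.mul Q.differentiable.differentiableOn) (p.differentiable.mul Q.differentiable)
    hρ0 hρ hδ0
  obtain ⟨a, ha, ha0⟩ := exists_norm_lt_forall_add_ne_zero (fun i => A₀.eval (w i)) hδ0
  have hdiff : DifferentiableOn ℂ (fun z => (A₀ + C a).eval z / Q.eval z) unitD :=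
    (A₀ + C a).differentiable.differentiableOn.div Q.differentiable.differentiableOn hQ0
  have hnear : ∀ z x : ℂ, ‖A₀.eval z - x‖ < δ → ‖(A₀ + C a).eval z - x‖ < δ + δ := by
    intro z x h
    rw [eval_add, eval_C, show A₀.eval z + a - x = (A₀.eval z - x) + a by ring]
    exact (norm_add_le _ _).trans_lt (add_lt_add h ha)
  let f : Hol unitD := ⟨unitD.indicator fun z => (A₀ + C a).eval z / Q.eval z,
    hdiff.congr (Set.eqOn_indicator), fun z hz => Set.indicator_of_notMem hz _⟩
  have hfz : ∀ z ∈ unitD, f.1 z = (A₀ + C a).eval z / Q.eval z :=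
    fun z hz => Set.indicator_of_mem hz fun z => (A₀ + C a).eval z / Q.eval z
  have hAf : ∀ z ∈ unitD, (A₀ + C a).eval z = f.1 z * Q.eval z := fun z hz => by
    rw [hfz z hz, div_mul_cancel₀ _ (hQ0 z hz)]
  refine ⟨f, A₀ + C a, fun m hm => ⟨hm, (natDegree_rootPoly hw0).le, isCoprime_rootPoly hw0 ?_,
    coeff_zero_rootPoly, fun j _ => sum_coeff_mul_tc f.2.1 hAf j⟩, hAf, fun z hz => ?_,
    fun z hz => ?_⟩
  · simpa using ha0
  · exact (hnear z _ (hA1 z hz)).trans_le hδ1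
  · rw [hfz z (hBD hz), div_sub' (hQ0 z (hBD hz)), norm_div, mul_comm,
      div_lt_iff₀ (norm_pos_iff.2 (hQ0 z (hBD hz)))]
    exact (hnear z _ (hA2 z hz)).trans_le (hδ2.trans (by gcongr; exact hc z hz))

/-- The polynomials are separable for uniform convergence on `closedBall 0 M`. -/
theorem exists_dense_polynomials (M : ℕ) : ∃ u : ℕ → ℂ[X], ∀ (p : ℂ[X]) (ε : ℝ), 0 < ε →
    ∃ n, ∀ z ∈ closedBall (0 : ℂ) M, ‖p.eval z - (u n).eval z‖ < ε := by
  let S : Set C(closedBall (0 : ℂ) M, ℂ) := Set.range fun p : ℂ[X] => p.toContinuousMapOn _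
  have : Nonempty S := ⟨⟨_, 0, rfl⟩⟩
  have : CompactSpace (closedBall (0 : ℂ) M) := isCompact_iff_compactSpace.1
    (isCompact_closedBall _ _)
  choose u hu using fun n => (TopologicalSpace.denseSeq S n).2
  refine ⟨u, fun p ε hε => ?_⟩
  obtain ⟨n, hn⟩ := (TopologicalSpace.denseRange_denseSeq S).exists_dist_lt ⟨_, p, rfl⟩ hε
  refine ⟨n, fun z hz => ?_⟩
  have := (ContinuousMap.dist_lt_iff hε).1 hn ⟨z, hz⟩
  rw [← hu n] at this
  simpa [dist_eq_norm] using this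

section padeEval
variable {m q : ℕ} {f : Hol unitD}

theorem continuousAt_eval_padeDen (h : hankelDet (tc f.1) m q ≠ 0) (z : ℂ) :
    ContinuousAt (fun x : Hol unitD × ℂ => (padeDen (tc x.1.1) m q).eval x.2) (f, z) :=
  continuousAt_eval_of_coeff (fun g : Hol unitD => natDegree_padeDen_le (tc g.1) m q)
    (fun k => (continuousAt_coeff_padeDen h k).comp_of_eq Hol.continuous_tc.continuousAt rfl) z

theorem continuousAt_eval_padeNum (h : hankelDet (tc f.1) m q ≠ 0) (z : ℂ) :
    ContinuousAt (fun x : Hol unitD × ℂ => (padeNum (tc x.1.1) m q).eval x.2) (f, z) :=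
  continuousAt_eval_of_coeff (fun g : Hol unitD => natDegree_padeNum_le (tc g.1) m q)
    (fun k => (continuousAt_coeff_padeNum h k).comp_of_eq Hol.continuous_tc.continuousAt rfl) z

end padeEval

/-- The functions with a Padé approximant of type `(μ n, q)`, `n ≥ N`, that is close to `p` on `L`,
close to the function on a large disc, and whose denominator is small at the points `w i`. -/
def padeSet (μ : ℕ → ℕ) {q : ℕ} (w : Fin q → ℂ) (L : Set ℂ) (p : ℂ[X]) (s N : ℕ) :
    Set (Hol unitD) :=
  {f | ∃ n ≥ N, hankelDet (tc f.1) (μ n) q ≠ 0 ∧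
    (∀ i, ‖(padeDen (tc f.1) (μ n) q).eval (w i)‖ <
      ‖(padeDen (tc f.1) (μ n) q).coeff q‖ * (1 / ((s : ℝ) + 1)) ^ q) ∧
    (∀ z ∈ L, ‖(padeNum (tc f.1) (μ n) q).eval z -
        p.eval z * (padeDen (tc f.1) (μ n) q).eval z‖ <
      ‖(padeDen (tc f.1) (μ n) q).eval z‖ * (1 / ((s : ℝ) + 1))) ∧
    ∀ z ∈ closedBall (0 : ℂ) (1 - 1 / ((s : ℝ) + 1)), ‖(padeNum (tc f.1) (μ n) q).eval z -
        f.1 z * (padeDen (tc f.1) (μ n) q).eval z‖ <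
      ‖(padeDen (tc f.1) (μ n) q).eval z‖ * (1 / ((s : ℝ) + 1))}

section padeSet
variable (μ : ℕ → ℕ) {q : ℕ} {w : Fin q → ℂ} {L : Set ℂ}

theorem isOpen_padeSet (hL : IsCompact L) (p : ℂ[X]) (s N : ℕ) :
    IsOpen (padeSet μ w L p s N) := by
  rw [isOpen_iff_mem_nhds]
  rintro f ⟨n, hn, hdet, hw, hLf, hD⟩
  have hdet' : ∀ᶠ g : Hol unitD in 𝓝 f, hankelDet (tc g.1) (μ n) q ≠ 0 :=
    ((continuous_hankelDet (μ n) q).comp Hol.continuous_tc).continuousAt.eventually_ne hdet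
  have hcoeff : ContinuousAt (fun g : Hol unitD => (padeDen (tc g.1) (μ n) q).coeff q) f :=
    (continuousAt_coeff_padeDen hdet q).comp_of_eq Hol.continuous_tc.continuousAt rfl
  have hw' : ∀ᶠ g : Hol unitD in 𝓝 f, ∀ i, ‖(padeDen (tc g.1) (μ n) q).eval (w i)‖ <
      ‖(padeDen (tc g.1) (μ n) q).coeff q‖ * (1 / ((s : ℝ) + 1)) ^ q := by
    refine eventually_all.2 fun i => ?_
    have h1 : ContinuousAt (fun g : Hol unitD => (padeDen (tc g.1) (μ n) q).eval (w i)) f :=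
      (continuousAt_eval_padeDen hdet (w i)).comp_of_eq
        (f := fun g : Hol unitD => (g, w i)) (by fun_prop) rfl
    exact h1.norm.eventually_lt (hcoeff.norm.mul_const _) (hw i)
  have hLf' := hL.eventually_forall_of_forall_eventually (x₀ := f)
    (P := fun (g : Hol unitD) z => ‖(padeNum (tc g.1) (μ n) q).eval z -
        p.eval z * (padeDen (tc g.1) (μ n) q).eval z‖ <
      ‖(padeDen (tc g.1) (μ n) q).eval z‖ * (1 / ((s : ℝ) + 1))) fun z hz => by
    have hd := continuousAt_eval_padeDen hdet z
    have hp : ContinuousAt (fun x : Hol unitD × ℂ => p.eval x.2) (f, z) := by fun_prop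
    exact (((continuousAt_eval_padeNum hdet z).sub (hp.mul hd)).norm).eventually_lt
      (hd.norm.mul_const _) (hLf z hz)
  have hD' := (isCompact_closedBall (0 : ℂ) (1 - 1 / ((s : ℝ) + 1))
    ).eventually_forall_of_forall_eventually (x₀ := f)
    (P := fun (g : Hol unitD) z => ‖(padeNum (tc g.1) (μ n) q).eval z -
        g.1 z * (padeDen (tc g.1) (μ n) q).eval z‖ <
      ‖(padeDen (tc g.1) (μ n) q).eval z‖ * (1 / ((s : ℝ) + 1))) fun z hz => by
    have hd := continuousAt_eval_padeDen hdet z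
    have hp := Hol.continuousAt_eval (f := f) (closedBall_subset_unitD s hz)
    exact (((continuousAt_eval_padeNum hdet z).sub (hp.mul hd)).norm).eventually_lt
      (hd.norm.mul_const _) (hD z hz)
  filter_upwards [hdet', hw', hLf', hD'] with g h1 h2 h3 h4
  exact ⟨n, hn, h1, h2, h3, h4⟩

theorem dense_of_forall_exists_near {S : Set (Hol unitD)}
    (h : ∀ (f₀ : Hol unitD) (n : ℕ), ∃ f ∈ S, ∀ z ∈ closedBall (0 : ℂ) (1 - 1 / ((n : ℝ) + 1)),
      ‖f.1 z - f₀.1 z‖ < 1 / ((n : ℝ) + 1)) : Dense S := by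
  intro f₀
  choose f hfS hf using h f₀
  refine mem_closure_of_tendsto (f := f) (b := atTop) ?_ (Eventually.of_forall hfS)
  rw [Hol.tendsto_nhds_iff, tendstoLocallyUniformlyOn_iff_forall_isCompact isOpen_unitD]
  intro K hKD hK
  obtain ⟨k, hk⟩ := exists_subset_closedBall_of_isCompact hK hKD
  rw [Metric.tendstoUniformlyOn_iff]
  intro ε hε
  obtain ⟨j, hj⟩ := exists_nat_one_div_lt hε
  filter_upwards [eventually_ge_atTop (max k j)] with n hn z hz
  have hkn : 1 / ((n : ℝ) + 1) ≤ 1 / ((k : ℝ) + 1) := by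
    have : k ≤ n := (le_max_left _ _).trans hn
    gcongr
  have hjn : 1 / ((n : ℝ) + 1) ≤ 1 / ((j : ℝ) + 1) := by
    have : j ≤ n := (le_max_right _ _).trans hn
    gcongr
  rw [dist_comm, dist_eq_norm]
  exact (hf n z (closedBall_subset_closedBall (by linarith) (hk hz))).trans_le (hjn.trans hj.le)

theorem dense_padeSet (hμ : ∀ N : ℕ, ∃ k, N < μ k) (hw : ∀ i, 1 < ‖w i‖) (hL : IsCompact L)
    (hLD : Disjoint L unitD) (hLc : IsPreconnected Lᶜ) (hwL : ∀ i, w i ∉ L) (p : ℂ[X]) (s N : ℕ) :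
    Dense (padeSet μ w L p s N) := by
  have hw0 : ∀ i, w i ≠ 0 := fun i h => by
    have := hw i
    rw [h, norm_zero] at this
    linarith
  have hμ' : ∀ a, ∃ n ≥ N, a ≤ μ n := by
    intro a
    obtain ⟨n, hn⟩ := hμ (max a ((Finset.range N).sup μ))
    refine ⟨n, ?_, ((le_max_left _ _).trans_lt hn).le⟩
    by_contra hc
    exact absurd ((le_max_right _ _).trans_lt hn)
      (Finset.le_sup (f := μ) (Finset.mem_range.2 (not_le.1 hc))).not_gt
  refine dense_of_forall_exists_near fun f₀ k => ?_
  have hs : 0 < 1 / ((s : ℝ) + 1) := by positivity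
  have hk : 0 < 1 / ((k : ℝ) + 1) := by positivity
  have hk1 : 1 / ((k : ℝ) + 1) ≤ 1 := (div_le_one (by positivity)).2 (by simp)
  obtain ⟨c, hc0, hc⟩ : ∃ c > 0, ∀ z ∈ L, c ≤ ‖(rootPoly w).eval z‖ :=
    hL.exists_forall_le' (f := fun z => ‖(rootPoly w).eval z‖) (by fun_prop) fun z hz =>
      norm_pos_iff.2 fun h => by
        obtain ⟨i, rfl⟩ := (eval_rootPoly_eq_zero_iff hw0).1 h
        exact hwL i hz
  obtain ⟨f, A, hA, hAf, hAL, hf⟩ := exists_hol_isPade_rootPoly hw hL hLD hLc p f₀.2.1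
    (sub_nonneg.2 hk1) (sub_lt_self 1 hk)
    (lt_min hk (mul_pos hc0 hs) : 0 < min _ (c * (1 / ((s : ℝ) + 1))))
  refine ⟨f, ?_, fun z hz => (hf z hz).trans_le (min_le_left _ _)⟩
  obtain ⟨n, hnN, hn⟩ := hμ' A.natDegree
  have hP := hA (μ n) hn
  have hdet := hP.hankelDet_ne_zero (natDegree_rootPoly hw0)
  refine ⟨n, hnN, hdet, ?_⟩
  rw [← hP.eq_padeDen hdet, ← hP.eq_padeNum hdet]
  refine ⟨fun i => ?_, fun z hz => ?_, fun z hz => ?_⟩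
  · rw [(eval_rootPoly_eq_zero_iff hw0).2 ⟨i, rfl⟩, norm_zero]
    have : (rootPoly w).coeff q ≠ 0 := by
      have := leadingCoeff_ne_zero.2 (rootPoly_ne_zero (w := w))
      rwa [leadingCoeff, natDegree_rootPoly hw0] at this
    positivity
  · exact ((hAL z hz).trans_le (min_le_right _ _)).trans_le (by gcongr; exact hc z hz)
  · have hzD := closedBall_subset_unitD s hz
    rw [hAf z hzD, sub_self, norm_zero]
    refine mul_pos (norm_pos_iff.2 fun h => ?_) hs
    obtain ⟨i, rfl⟩ := (eval_rootPoly_eq_zero_iff hw0).1 h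
    have h1 : ‖w i‖ < 1 := by simpa [unitD] using hzD
    exact absurd (hw i) h1.not_gt

end padeSet

theorem exists_root_near {Q : ℂ[X]} {q : ℕ} (hQ : Q.natDegree = q) {w : ℂ} {δ : ℝ} (hδ : 0 < δ)
    (h : ‖Q.eval w‖ < ‖Q.coeff q‖ * δ ^ q) : ∃ r ∈ Q.roots, ‖r - w‖ < δ := by
  by_contra! hc
  have hs := IsAlgClosed.splits Q
  have hprod : ∀ s : Multiset ℂ, (∀ r ∈ s, δ ≤ ‖r - w‖) →
      δ ^ Multiset.card s ≤ ‖(s.map fun r => w - r).prod‖ := by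
    intro s
    induction s using Multiset.induction_on with
    | empty => simp
    | cons a s ih =>
      intro hs
      rw [Multiset.card_cons, pow_succ', Multiset.map_cons, Multiset.prod_cons, norm_mul,
        norm_sub_rev]
      exact mul_le_mul (hs a (Multiset.mem_cons_self _ _))
        (ih fun r hr => hs r (Multiset.mem_cons_of_mem hr)) (by positivity) (norm_nonneg _)
  have h1 := hprod Q.roots hc
  rw [← hs.natDegree_eq_card_roots, hQ] at h1
  have h2 : Q.eval w = Q.coeff q * (Q.roots.map fun r => w - r).prod := by
    rw [hs.eval_eq_prod_roots, leadingCoeff, hQ]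
  rw [h2, norm_mul] at h
  exact absurd (mul_le_mul_of_nonneg_left h1 (norm_nonneg (Q.coeff q))) h.not_ge

theorem eq_C_leadingCoeff_mul_prod {Q : ℂ[X]} {q : ℕ} (hQ : Q.natDegree = q) {r : Fin q → ℂ}
    (hr : ∀ i, r i ∈ Q.roots) (hinj : Function.Injective r) :
    Q = C Q.leadingCoeff * ∏ i, (X - C (r i)) := by
  have hs := IsAlgClosed.splits Q
  have hle : Finset.univ.val.map r ≤ Q.roots := by
    rw [Multiset.le_iff_subset (Finset.univ.nodup.map hinj)]
    intro x hx
    obtain ⟨i, -, rfl⟩ := Multiset.mem_map.1 hx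
    exact hr i
  have heq : Finset.univ.val.map r = Q.roots := by
    refine Multiset.eq_of_le_of_card_le hle ?_
    rw [← hs.natDegree_eq_card_roots, hQ]
    simp
  conv_lhs => rw [hs.eq_prod_roots, ← heq, Multiset.map_map]
  rfl

theorem exists_sorted_roots {Q : ℂ[X]} {q : ℕ} (hq : 1 ≤ q) (hQ : Q.natDegree ≤ q)
    {w : Fin q → ℂ} {δ : ℝ} (hδ : 0 < δ) (hw : ∀ i j, i < j → ‖w i‖ + 2 * δ ≤ ‖w j‖)
    (h : ∀ i, ‖Q.eval (w i)‖ < ‖Q.coeff q‖ * δ ^ q) :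
    Q.degree = q ∧ ∃ r : Fin q → ℂ, Q = C Q.leadingCoeff * ∏ i, (X - C (r i)) ∧
      (∀ i, ‖r i - w i‖ < δ) ∧ StrictMono fun i => ‖r i‖ := by
  have hc : Q.coeff q ≠ 0 := by
    intro h0
    have := h ⟨0, hq⟩
    rw [h0, norm_zero, zero_mul] at this
    exact absurd this (norm_nonneg _).not_gt
  have hn : Q.natDegree = q := le_antisymm hQ (le_natDegree_of_ne_zero hc)
  have hQ0 : Q ≠ 0 := by
    rintro rfl
    simp at hc
  choose r hr hrw using fun i => exists_root_near hn hδ (h i)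
  have hmono : StrictMono fun i => ‖r i‖ := by
    intro i j hij
    have h1 := norm_sub_norm_le (r i) (w i)
    have h2 := norm_sub_norm_le (w j) (r j)
    rw [norm_sub_rev] at h2
    show ‖r i‖ < ‖r j‖
    linarith [hw i j hij, hrw i, hrw j]
  refine ⟨by rw [degree_eq_natDegree hQ0, hn], r, eq_C_leadingCoeff_mul_prod hn hr ?_, hrw, hmono⟩
  exact fun i j hij => hmono.injective (congrArg norm hij)

theorem polarLe_of_strictMono {q : ℕ} {r : Fin q → ℂ} (h : StrictMono fun i => ‖r i‖) (α : ℝ)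
    {i j : Fin q} (hij : i ≤ j) : polarLe α (r i) (r j) := by
  rcases hij.lt_or_eq with h' | rfl
  · exact Or.inl (h h')
  · exact Or.inr ⟨rfl, le_rfl⟩

theorem polarLe.norm_le {α : ℝ} {z w : ℂ} (h : polarLe α z w) : ‖z‖ ≤ ‖w‖ :=
  h.elim le_of_lt fun h => h.1.le

theorem exists_polarArg_ne {q : ℕ} (w : Fin q → ℂ) :
    ∃ α ∈ Set.Ico (0 : ℝ) (2 * Real.pi), ∀ i, polarArg α (w i) ≠ α := by
  classical
  have hπ := Real.pi_pos
  have hinf : (Set.Ico (0 : ℝ) (2 * Real.pi)).Infinite := Set.Ico_infinite (by linarith)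
  obtain ⟨α, hα, hαw⟩ := hinf.exists_notMem_finset
    ((Finset.univ.image fun i => (w i).arg) ∪ Finset.univ.image fun i => (w i).arg + 2 * Real.pi)
  refine ⟨α, hα, fun i hi => hαw ?_⟩
  have h0 : Int.fract (((w i).arg - α) / (2 * Real.pi)) = 0 := by
    have : 2 * Real.pi * Int.fract (((w i).arg - α) / (2 * Real.pi)) = 0 := by
      unfold polarArg at hi
      linarith
    exact (mul_eq_zero.1 this).resolve_left (by positivity)
  obtain ⟨n, hn⟩ := Int.fract_eq_zero_iff.1 h0
  rw [eq_div_iff (by positivity)] at hn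
  have h1 := Complex.neg_pi_lt_arg (w i)
  have h2 := Complex.arg_le_pi (w i)
  have hn1 : n < 1 := by
    by_contra! hc
    have : (1 : ℝ) ≤ n := by exact_mod_cast hc
    nlinarith [hα.1]
  have hn2 : -2 < n := by
    by_contra! hc
    have : (n : ℝ) ≤ -2 := by exact_mod_cast hc
    nlinarith [hα.2]
  obtain rfl | rfl : n = 0 ∨ n = -1 := by omega
  · refine Finset.mem_union_left _ (Finset.mem_image.2 ⟨i, mem_univ i, ?_⟩)
    push_cast at hn
    linarith
  · refine Finset.mem_union_right _ (Finset.mem_image.2 ⟨i, mem_univ i, ?_⟩)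
    push_cast at hn
    linarith

/-- The functions all of whose universal Padé approximation properties hold: prescribed limits of
the Padé approximants off the disc together with prescribed limits of the poles. -/
def universalSet (μ : ℕ → ℕ) (q : ℕ) : Set (Hol unitD) :=
  {f : Hol unitD |
      ∀ α ∈ Set.Ico (0 : ℝ) (2 * Real.pi), ∀ w : Fin q → ℂ,
        (∀ i, 1 ≤ ‖w i‖) → (∀ i, polarArg α (w i) ≠ α) →
        (∀ i j : Fin q, i ≤ j → polarLe α (w i) (w j)) →
        ∀ K : Set ℂ, IsCompact K → Disjoint K (unitD ∪ Set.range w) → IsConnected Kᶜ →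
        ∀ h : ℂ → ℂ, ContinuousOn h K → DifferentiableOn ℂ h (interior K) →
        ∃ σ : ℕ → ℕ, StrictMono σ ∧ ∃ P Q : ℕ → Polynomial ℂ,
          (∀ k, tc f.1 ∈ Nset (μ (σ k)) q ∧
            IsPade (tc f.1) (μ (σ k)) q (P k) (Q k)) ∧
          TendstoUniformlyOn (fun k z => (P k).eval z / (Q k).eval z) h atTop K ∧
          TendstoLocallyUniformlyOn
            (fun k z => (P k).eval z / (Q k).eval z) f.1 atTop unitD ∧
          ∃ r : ℕ → Fin q → ℂ,
            (∀ k, Q k = Polynomial.C ((Q k).leadingCoeff) *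
                ∏ i : Fin q, (Polynomial.X - Polynomial.C (r k i)) ∧
              ∀ i j : Fin q, i ≤ j → polarLe α (r k i) (r k j)) ∧
            ∀ i : Fin q, Tendsto (fun k => r k i) atTop (nhds (w i))}

section universalSet
variable {μ : ℕ → ℕ} {q : ℕ}

theorem eventually_forall_eval_ne_zero {w : Fin q → ℂ} {r : ℕ → Fin q → ℂ} {Q : ℕ → ℂ[X]}
    (hQ0 : ∀ k, Q k ≠ 0) (hQ : ∀ k, Q k = C (Q k).leadingCoeff * ∏ i, (X - C (r k i)))
    (hr : ∀ i, Tendsto (fun k => r k i) atTop (𝓝 (w i))) {L : Set ℂ} (hL : IsClosed L)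
    (hwL : ∀ i, w i ∉ L) : ∀ᶠ k in atTop, ∀ z ∈ L, (Q k).eval z ≠ 0 := by
  filter_upwards [eventually_all.2 fun i => hr i (hL.isOpen_compl.mem_nhds (hwL i))]
    with k hk z hz h0
  rw [hQ k, eval_mul, eval_C, eval_prod, mul_eq_zero] at h0
  rcases h0 with h0 | h0
  · exact hQ0 k (leadingCoeff_eq_zero.1 h0)
  · obtain ⟨i, -, hi⟩ := Finset.prod_eq_zero_iff.1 h0
    have hzi : z = r k i := by simpa [sub_eq_zero] using hi
    exact hk i (hzi ▸ hz)

theorem norm_sub_mul_lt_of_dist_lt {a b c : ℂ} {ε : ℝ} (hb : b ≠ 0) (h : dist c (a / b) < ε) :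
    ‖a - c * b‖ < ‖b‖ * ε := by
  rw [dist_comm, dist_eq_norm, div_sub' hb, norm_div, div_lt_iff₀ (norm_pos_iff.2 hb)] at h
  rwa [mul_comm c, mul_comm ‖b‖]

theorem dist_lt_of_norm_sub_mul_lt {a b c : ℂ} {ε : ℝ} (h : ‖a - c * b‖ < ‖b‖ * ε) :
    dist c (a / b) < ε := by
  have hb : b ≠ 0 := by
    rintro rfl
    rw [norm_zero, zero_mul] at h
    exact absurd h (norm_nonneg _).not_gt
  rw [dist_comm, dist_eq_norm, div_sub' hb, norm_div, div_lt_iff₀ (norm_pos_iff.2 hb)]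
  rwa [mul_comm b, mul_comm ε]

theorem universalSet_subset_padeSet {w : Fin q → ℂ} (hw : ∀ i, 1 < ‖w i‖)
    (hmono : StrictMono fun i => ‖w i‖) {L : Set ℂ} (hL : IsCompact L) (hLD : Disjoint L unitD)
    (hLc : IsPreconnected Lᶜ) (hwL : ∀ i, w i ∉ L) (p : ℂ[X]) (s N : ℕ) :
    universalSet μ q ⊆ padeSet μ w L p s N := by
  intro f hf
  obtain ⟨α, hα, hαw⟩ := exists_polarArg_ne w
  have h0L : (0 : ℂ) ∈ Lᶜ := fun h => Set.disjoint_left.1 hLD h zero_mem_unitD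
  have hLw : Disjoint L (unitD ∪ Set.range w) := by
    refine Set.disjoint_union_right.2 ⟨hLD, Set.disjoint_left.2 ?_⟩
    rintro _ h ⟨i, rfl⟩
    exact hwL i h
  obtain ⟨σ, hσ, P, Q, hPQ, hunif, hloc, r, hr, hrw⟩ := hf α hα w (fun i => (hw i).le) hαw
    (fun i j => polarLe_of_strictMono hmono α) L hL hLw ⟨⟨0, h0L⟩, hLc⟩ (fun z => p.eval z)
    p.continuous.continuousOn p.differentiable.differentiableOn
  have hs : 0 < 1 / ((s : ℝ) + 1) := by positivity
  have hQ0 : ∀ k, Q k ≠ 0 := fun k h => by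
    have := (hPQ k).2.2.2.2.1
    simp [h] at this
  have hB : closedBall (0 : ℂ) (1 - 1 / ((s : ℝ) + 1)) ⊆ unitD := closedBall_subset_unitD s
  have hwB : ∀ i, w i ∉ closedBall (0 : ℂ) (1 - 1 / ((s : ℝ) + 1)) := fun i h => by
    have h1 : ‖w i‖ < 1 := by simpa [unitD] using hB h
    exact absurd (hw i) h1.not_gt
  have hdeg : ∀ k, (Q k).natDegree = q := by
    intro k
    rw [(hr k).1, natDegree_C_mul (leadingCoeff_ne_zero.2 (hQ0 k)),
      natDegree_finsetProd_X_sub_C_eq_card, Finset.card_fin]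
  have hsmall : ∀ᶠ k in atTop, ∀ i, ‖(Q k).eval (w i)‖ <
      ‖(Q k).coeff q‖ * (1 / ((s : ℝ) + 1)) ^ q := by
    refine eventually_all.2 fun i => ?_
    have ht : Tendsto (fun k => ‖∏ j, (w i - r k j)‖) atTop (𝓝 0) := by
      have : Tendsto (fun k => ∏ j, (w i - r k j)) atTop (𝓝 (∏ j, (w i - w j))) :=
        tendsto_finsetProd _ fun j _ => tendsto_const_nhds.sub (hrw j)
      rw [Finset.prod_eq_zero (mem_univ i) (sub_self (w i))] at this
      simpa using this.norm
    filter_upwards [ht.eventually_lt_const (pow_pos hs q)] with k hk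
    have he : (Q k).eval (w i) = (Q k).coeff q * ∏ j, (w i - r k j) := by
      conv_lhs => rw [(hr k).1]
      rw [leadingCoeff, hdeg k]
      simp [eval_prod]
    have hc : (Q k).coeff q ≠ 0 := by
      have := leadingCoeff_ne_zero.2 (hQ0 k)
      rwa [leadingCoeff, hdeg k] at this
    rw [he, norm_mul]
    gcongr
  have hloc' := (tendstoLocallyUniformlyOn_iff_forall_isCompact isOpen_unitD).1 hloc _ hB
    (isCompact_closedBall _ _)
  have h1 := fun k => (hr k).1
  obtain ⟨k, hkN, hks, hkL, hkB, hku, hkl⟩ := ((eventually_ge_atTop N).and <| hsmall.and <|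
    (eventually_forall_eval_ne_zero hQ0 h1 hrw hL.isClosed hwL).and <|
    (eventually_forall_eval_ne_zero hQ0 h1 hrw isClosed_closedBall hwB).and <|
    (Metric.tendstoUniformlyOn_iff.1 hunif _ hs).and
    (Metric.tendstoUniformlyOn_iff.1 hloc' _ hs)).exists
  have hdet := (hPQ k).1.1
  refine ⟨σ k, hkN.trans (hσ.id_le k), hdet, ?_⟩
  rw [← (hPQ k).2.eq_padeDen hdet, ← (hPQ k).2.eq_padeNum hdet]
  exact ⟨hks, fun z hz => norm_sub_mul_lt_of_dist_lt (hkL z hz) (hku z hz),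
    fun z hz => norm_sub_mul_lt_of_dist_lt (hkB z hz) (hkl z hz)⟩

end universalSet

/-- Tuples of points outside the closed unit disc with strictly increasing moduli. -/
abbrev SortedTuple (q : ℕ) :=
  {w : Fin q → ℂ // (∀ i, 1 < ‖w i‖) ∧ StrictMono fun i => ‖w i‖}

theorem exists_sortedTuple_near {q : ℕ} {w : Fin q → ℂ} (hw : ∀ i, 1 ≤ ‖w i‖)
    (hmono : ∀ i j, i ≤ j → ‖w i‖ ≤ ‖w j‖) {ε : ℝ} (hε : 0 < ε) :
    ∃ v : SortedTuple q, dist v.1 w < ε := by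
  have ht : Tendsto (fun (t : ℝ) (i : Fin q) => ((1 + t * ((i : ℝ) + 1) : ℝ) : ℂ) * w i)
      (𝓝[>] 0) (𝓝 w) := by
    refine (Continuous.tendsto' ?_ 0 w ?_).mono_left nhdsWithin_le_nhds
    · fun_prop
    · ext i
      simp
  obtain ⟨t, htw, ht0⟩ := ((ht.eventually (ball_mem_nhds w hε)).and self_mem_nhdsWithin).exists
  have hnorm : ∀ i : Fin q, ‖((1 + t * ((i : ℝ) + 1) : ℝ) : ℂ) * w i‖ =
      (1 + t * ((i : ℝ) + 1)) * ‖w i‖ := by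
    intro i
    rw [norm_mul, Complex.norm_real, Real.norm_of_nonneg (by positivity)]
  refine ⟨⟨_, fun i => ?_, fun i j hij => ?_⟩, htw⟩
  · rw [hnorm]
    have : 0 < t * ((i : ℝ) + 1) := by positivity
    nlinarith [hw i]
  · show ‖((1 + t * ((i : ℝ) + 1) : ℝ) : ℂ) * w i‖ < ‖((1 + t * ((j : ℝ) + 1) : ℝ) : ℂ) * w j‖
    rw [hnorm, hnorm]
    have hij' : (i : ℝ) < (j : ℝ) := by exact_mod_cast hij
    have h1 : 1 + t * ((i : ℝ) + 1) < 1 + t * ((j : ℝ) + 1) := by gcongr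
    exact mul_lt_mul h1 (hmono i j hij.le) (by linarith [hw i]) (by positivity)

instance (q : ℕ) : Nonempty (SortedTuple q) :=
  ⟨fun i => ((i : ℕ) : ℂ) + 2, by
    have hnorm : ∀ i : Fin q, ‖((i : ℕ) : ℂ) + 2‖ = (i : ℕ) + 2 := fun i => by
      have := Complex.norm_natCast ((i : ℕ) + 2)
      push_cast at this
      exact this
    refine ⟨fun i => ?_, fun i j hij => ?_⟩
    · rw [hnorm]
      linarith [Nat.cast_nonneg (α := ℝ) (i : ℕ)]
    · simp only [hnorm]
      have : ((i : ℕ) : ℝ) < ((j : ℕ) : ℝ) := by exact_mod_cast hij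
      linarith⟩

theorem exists_gap {q : ℕ} {w : Fin q → ℂ} (hw : StrictMono fun i => ‖w i‖) :
    ∃ δ > 0, ∀ i j, i < j → ‖w i‖ + 2 * δ ≤ ‖w j‖ := by
  have h : ∀ᶠ δ : ℝ in 𝓝[>] 0, ∀ i j, i < j → ‖w i‖ + 2 * δ ≤ ‖w j‖ := by
    refine eventually_all.2 fun i => eventually_all.2 fun j => ?_
    by_cases hij : i < j
    · have ht : Tendsto (fun δ : ℝ => ‖w i‖ + 2 * δ) (𝓝 0) (𝓝 ‖w i‖) :=
        Continuous.tendsto' (by fun_prop) 0 _ (by simp)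
      filter_upwards [nhdsWithin_le_nhds (ht.eventually_lt_const (hw hij))] with δ hδ _
      exact hδ.le
    · exact Eventually.of_forall fun δ h => absurd h hij
  obtain ⟨δ, h1, h2⟩ := (h.and self_mem_nhdsWithin).exists
  exact ⟨δ, h2, h1⟩

/-- A sequence of polynomials that is dense for uniform convergence on `closedBall 0 M`. -/
def densePoly (M : ℕ) : ℕ → ℂ[X] := (exists_dense_polynomials M).choose

theorem exists_densePoly_near (M : ℕ) (p : ℂ[X]) {ε : ℝ} (hε : 0 < ε) :
    ∃ n, ∀ z ∈ closedBall (0 : ℂ) M, ‖p.eval z - (densePoly M n).eval z‖ < ε :=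
  (exists_dense_polynomials M).choose_spec p ε hε

/-- The index set of the countable intersection describing `universalSet`. -/
abbrev AdmissibleIndex (q : ℕ) :=
  {x : ℕ × ℕ × Finset (ℕ × ℕ) × ℕ × ℕ × ℕ //
    IsPreconnected (exhaustingCompact x.2.1 x.2.2.1)ᶜ ∧
    ∀ i, (TopologicalSpace.denseSeq (SortedTuple q) x.1).1 i ∉ exhaustingCompact x.2.1 x.2.2.1}

/-- The `padeSet` attached to an index. -/
def indexedPadeSet (μ : ℕ → ℕ) (q : ℕ) (x : AdmissibleIndex q) : Set (Hol unitD) :=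
  padeSet μ (TopologicalSpace.denseSeq (SortedTuple q) x.1.1).1
    (exhaustingCompact x.1.2.1 x.1.2.2.1) (densePoly x.1.2.1 x.1.2.2.2.1)
    x.1.2.2.2.2.1 x.1.2.2.2.2.2

section
variable {μ : ℕ → ℕ} {q : ℕ}

theorem universalSet_subset_iInter : universalSet μ q ⊆ ⋂ x, indexedPadeSet μ q x :=
  Set.subset_iInter fun x => universalSet_subset_padeSet
    (TopologicalSpace.denseSeq (SortedTuple q) x.1.1).2.1
    (TopologicalSpace.denseSeq (SortedTuple q) x.1.1).2.2 (isCompact_exhaustingCompact _ _)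
    (disjoint_exhaustingCompact _ _) x.2.1 x.2.2 _ _ _

theorem exists_isPade_near {f : Hol unitD} (hf : f ∈ ⋂ x, indexedPadeSet μ q x) (hq : 1 ≤ q)
    {w : Fin q → ℂ} (hw : ∀ i, 1 ≤ ‖w i‖) (hmono : ∀ i j, i ≤ j → ‖w i‖ ≤ ‖w j‖) {K : Set ℂ}
    (hK : IsCompact K) (hKw : Disjoint K (unitD ∪ Set.range w)) (hKc : IsConnected Kᶜ) {h : ℂ → ℂ}
    (hc : ContinuousOn h K) (hd : DifferentiableOn ℂ h (interior K)) (k N : ℕ) :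
    ∃ n ≥ N, ∃ (P Q : ℂ[X]) (r : Fin q → ℂ), tc f.1 ∈ Nset (μ n) q ∧ IsPade (tc f.1) (μ n) q P Q ∧
      (∀ z ∈ K, dist (h z) (P.eval z / Q.eval z) < 1 / ((k : ℝ) + 1)) ∧
      (∀ z ∈ closedBall (0 : ℂ) (1 - 1 / ((k : ℝ) + 1)),
        dist (f.1 z) (P.eval z / Q.eval z) < 1 / ((k : ℝ) + 1)) ∧
      Q = C Q.leadingCoeff * ∏ i, (X - C (r i)) ∧ (StrictMono fun i => ‖r i‖) ∧
      ∀ i, dist (r i) (w i) < 1 / ((k : ℝ) + 1) := by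
  set ε := 1 / ((k : ℝ) + 1) with hε
  have hε0 : 0 < ε := by positivity
  rw [Set.disjoint_union_right] at hKw
  obtain ⟨M, F, hKL, hLc, hwL⟩ := exists_exhaustingCompact hK hKw.1 hKc (Set.finite_range w) hKw.2
  have hL := isCompact_exhaustingCompact M F
  have hwnear : ∀ᶠ v : Fin q → ℂ in 𝓝 w, ∀ i, v i ∉ exhaustingCompact M F :=
    eventually_all.2 fun i => (continuous_apply i).continuousAt.eventually
      (hL.isClosed.isOpen_compl.mem_nhds (Set.disjoint_left.1 hwL ⟨i, rfl⟩))
  obtain ⟨η, hη0, hη⟩ := Metric.eventually_nhds_iff.1 hwnear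
  have hη' : 0 < min η (ε / 2) / 2 := by positivity
  obtain ⟨v, hv⟩ := exists_sortedTuple_near hw hmono hη'
  obtain ⟨a, ha⟩ := (TopologicalSpace.denseRange_denseSeq (SortedTuple q)).exists_dist_lt v hη'
  set u := TopologicalSpace.denseSeq (SortedTuple q) a with hu
  have huw : dist u.1 w < min η (ε / 2) := by
    calc dist u.1 w ≤ dist v.1 u.1 + dist v.1 w := dist_triangle_left _ _ _
      _ < min η (ε / 2) := by
        have : dist v.1 u.1 < min η (ε / 2) / 2 := ha
        linarith
  obtain ⟨p, hp⟩ := polyApprox_of_differentiableOn_interior hK hKc.isPreconnected hc hd (ε / 3)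
    (by positivity)
  obtain ⟨b, hb⟩ := exists_densePoly_near M p (show 0 < ε / 3 by positivity)
  obtain ⟨δ, hδ0, hδ⟩ := exists_gap u.2.2
  obtain ⟨s, hs⟩ := exists_nat_one_div_lt (lt_min hδ0 (show 0 < ε / 3 by positivity))
  have hsδ := (hs.trans_le (min_le_left _ _)).le
  have hsε := hs.trans_le (min_le_right _ _)
  have hs0 : 0 < 1 / ((s : ℝ) + 1) := by positivity
  obtain ⟨n, hnN, hdet, hwQ, hLQ, hDQ⟩ := Set.mem_iInter.1 hf
    ⟨(a, M, F, b, s, N), hLc, hη (huw.trans_le (min_le_left _ _))⟩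
  simp only at hnN hdet hwQ hLQ hDQ
  have hP := isPade_padeNum_padeDen hdet
  obtain ⟨hdeg, r, hQr, hru, hrmono⟩ := exists_sorted_roots hq (natDegree_padeDen_le _ _ _) hs0
    (fun i j hij => by linarith [hδ i j hij]) hwQ
  refine ⟨n, hnN, _, _, r, ⟨hdet, _, _, hP, hdeg⟩, hP, fun z hz => ?_, fun z hz => ?_, hQr, hrmono,
    fun i => ?_⟩
  · have h1 := dist_lt_of_norm_sub_mul_lt (hLQ z (hKL hz))
    have h2 := hp z hz
    have h3 := hb z (hKL hz).1
    rw [← dist_eq_norm] at h2 h3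
    have h4 := dist_triangle4 (h z) (p.eval z) ((densePoly M b).eval z)
      ((padeNum (tc f.1) (μ n) q).eval z / (padeDen (tc f.1) (μ n) q).eval z)
    linarith
  · refine (dist_lt_of_norm_sub_mul_lt (hDQ z (closedBall_subset_closedBall ?_ hz))).trans ?_ <;>
      linarith
  · have h1 : dist (r i) (u.1 i) < 1 / ((s : ℝ) + 1) := by
      rw [dist_eq_norm]
      exact hru i
    have h2 : dist (u.1 i) (w i) < ε / 2 :=
      (dist_le_pi_dist u.1 w i).trans_lt (huw.trans_le (min_le_right _ _))
    linarith [dist_triangle (r i) (u.1 i) (w i)]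

theorem iInter_subset_universalSet (hq : 1 ≤ q) :
    ⋂ x, indexedPadeSet μ q x ⊆ universalSet μ q := by
  intro f hf α _ w hw _ hwα K hK hKw hKc h hc hd
  have hmono : ∀ i j, i ≤ j → ‖w i‖ ≤ ‖w j‖ := fun i j hij => (hwα i j hij).norm_le
  obtain ⟨σ, hσ, hσp⟩ := extraction_forall_of_frequently
    (fun k => frequently_atTop.2 fun N => exists_isPade_near hf hq hw hmono hK hKw hKc hc hd k N)
  choose P Q r hN hP hPK hPD hQr hrmono hrw using hσp
  have hlim : ∀ ε : ℝ, 0 < ε → ∀ᶠ k : ℕ in atTop, 1 / ((k : ℝ) + 1) < ε := fun ε hε =>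
    tendsto_one_div_add_atTop_nhds_zero_nat.eventually_lt_const hε
  refine ⟨σ, hσ, P, Q, fun k => ⟨hN k, hP k⟩, ?_, ?_, r, fun k => ⟨hQr k, fun i j =>
    polarLe_of_strictMono (hrmono k) α⟩, fun i => ?_⟩
  · rw [Metric.tendstoUniformlyOn_iff]
    intro ε hε
    filter_upwards [hlim ε hε] with k hk z hz
    exact (hPK k z hz).trans hk
  · rw [tendstoLocallyUniformlyOn_iff_forall_isCompact isOpen_unitD]
    intro S hSD hS
    obtain ⟨j, hj⟩ := exists_subset_closedBall_of_isCompact hS hSD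
    rw [Metric.tendstoUniformlyOn_iff]
    intro ε hε
    filter_upwards [hlim ε hε, eventually_ge_atTop j] with k hk hjk z hz
    have hkj : 1 / ((k : ℝ) + 1) ≤ 1 / ((j : ℝ) + 1) := by gcongr
    exact (hPD k z (closedBall_subset_closedBall (by linarith) (hj hz))).trans hk
  · rw [Metric.tendsto_nhds]
    intro ε hε
    filter_upwards [hlim ε hε] with k hk
    exact (hrw k i).trans hk

theorem universalSet_eq_iInter (hq : 1 ≤ q) :
    universalSet μ q = ⋂ x, indexedPadeSet μ q x :=
  universalSet_subset_iInter.antisymm (iInter_subset_universalSet hq)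

theorem isOpen_indexedPadeSet (x : AdmissibleIndex q) : IsOpen (indexedPadeSet μ q x) :=
  isOpen_padeSet μ (isCompact_exhaustingCompact _ _) _ _ _

theorem isGδ_universalSet (hq : 1 ≤ q) : IsGδ (universalSet μ q) := by
  rw [universalSet_eq_iInter hq]
  exact .iInter_of_isOpen isOpen_indexedPadeSet

theorem dense_universalSet (hμ : ∀ N : ℕ, ∃ k, N < μ k) (hq : 1 ≤ q) :
    Dense (universalSet μ q) := by
  rw [universalSet_eq_iInter hq]
  exact dense_iInter_of_isOpen isOpen_indexedPadeSet fun x => dense_padeSet μ hμ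
    (TopologicalSpace.denseSeq (SortedTuple q) x.1.1).2.1 (isCompact_exhaustingCompact _ _)
    (disjoint_exhaustingCompact _ _) x.2.1 x.2.2 _ _ _

end

/-- Theorem 4.15 : for an unbounded sequence `μ` of positive integers and `q ≥ 1`, the
set `𝒰̃^{μ,q}(𝔻)` of `f ∈ H(𝔻)` such that for every ordered tuple `W = (w⁽¹⁾, …, w⁽ᑫ⁾)`
of points of `ℂ ∖ 𝔻`, every compact `K ⊆ ℂ ∖ (𝔻 ∪ W)` with connected complement and
every `h ∈ A(K)`, some subsequence `(λ_n)` of `μ` satisfies a) `f ∈ 𝒩_{λ_n,q}`;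
b) `[f; λ_n/q] → h` in `A(K)`; c) `[f; λ_n/q] → f` in `H(𝔻)`; d) the ordered roots of
the Padé denominators `Q_{λ_n,q}(f)` converge to `w⁽¹⁾, …, w⁽ᑫ⁾`, is a dense `G_δ`
subset of `H(𝔻)`. -/
theorem stmt_16 (μ : ℕ → ℕ) (hμpos : ∀ k, 0 < μ k) (hμub : ∀ N : ℕ, ∃ k, N < μ k)
    (q : ℕ) (hq : 1 ≤ q) :
    IsGδ {f : Hol unitD |
      ∀ α ∈ Set.Ico (0 : ℝ) (2 * Real.pi), ∀ w : Fin q → ℂ,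
        (∀ i, 1 ≤ ‖w i‖) → (∀ i, polarArg α (w i) ≠ α) →
        (∀ i j : Fin q, i ≤ j → polarLe α (w i) (w j)) →
        ∀ K : Set ℂ, IsCompact K → Disjoint K (unitD ∪ Set.range w) → IsConnected Kᶜ →
        ∀ h : ℂ → ℂ, ContinuousOn h K → DifferentiableOn ℂ h (interior K) →
        ∃ σ : ℕ → ℕ, StrictMono σ ∧ ∃ P Q : ℕ → Polynomial ℂ,
          (∀ k, tc f.1 ∈ Nset (μ (σ k)) q ∧
            IsPade (tc f.1) (μ (σ k)) q (P k) (Q k)) ∧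
          TendstoUniformlyOn (fun k z => (P k).eval z / (Q k).eval z) h atTop K ∧
          TendstoLocallyUniformlyOn
            (fun k z => (P k).eval z / (Q k).eval z) f.1 atTop unitD ∧
          ∃ r : ℕ → Fin q → ℂ,
            (∀ k, Q k = Polynomial.C ((Q k).leadingCoeff) *
                ∏ i : Fin q, (Polynomial.X - Polynomial.C (r k i)) ∧
              ∀ i j : Fin q, i ≤ j → polarLe α (r k i) (r k j)) ∧
            ∀ i : Fin q, Tendsto (fun k => r k i) atTop (nhds (w i))} ∧
    Dense {f : Hol unitD |
      ∀ α ∈ Set.Ico (0 : ℝ) (2 * Real.pi), ∀ w : Fin q → ℂ,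
        (∀ i, 1 ≤ ‖w i‖) → (∀ i, polarArg α (w i) ≠ α) →
        (∀ i j : Fin q, i ≤ j → polarLe α (w i) (w j)) →
        ∀ K : Set ℂ, IsCompact K → Disjoint K (unitD ∪ Set.range w) → IsConnected Kᶜ →
        ∀ h : ℂ → ℂ, ContinuousOn h K → DifferentiableOn ℂ h (interior K) →
        ∃ σ : ℕ → ℕ, StrictMono σ ∧ ∃ P Q : ℕ → Polynomial ℂ,
          (∀ k, tc f.1 ∈ Nset (μ (σ k)) q ∧
            IsPade (tc f.1) (μ (σ k)) q (P k) (Q k)) ∧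
          TendstoUniformlyOn (fun k z => (P k).eval z / (Q k).eval z) h atTop K ∧
          TendstoLocallyUniformlyOn
            (fun k z => (P k).eval z / (Q k).eval z) f.1 atTop unitD ∧
          ∃ r : ℕ → Fin q → ℂ,
            (∀ k, Q k = Polynomial.C ((Q k).leadingCoeff) *
                ∏ i : Fin q, (Polynomial.X - Polynomial.C (r k i)) ∧
              ∀ i j : Fin q, i ≤ j → polarLe α (r k i) (r k j)) ∧
            ∀ i : Fin q, Tendsto (fun k => r k i) atTop (nhds (w i))} :=
  ⟨isGδ_universalSet hq, dense_universalSet hμub hq⟩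

end
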